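/- arXiv:1312.6743 — 10 statements merged into one kernel-verified Lean document; each statement's English description precedes it below -/
import Mathlib

section
/- For every WSREMin-feasible tuple (T, ρ, p, t) there exists a WSREMin-feasible tuple (T', ρ', p', t') such that the time-sharing factors of each MT are equal across subcarriers (ρ'_{k,n} = ρ'_{k,m} for all subcarriers n, m and every MT k), the on-time of each MT equals its total allocated transmission time (t'_k = T'·ρ'_{k,n} for every k and n), and the weighted-sum receiver energy does not increase: Σ_k α_k·P_rc·t'_k ≤ Σ_k α_k·P_rc·t_k. In other words, Dynamic TDMA (each MT occupying all subcarriers during its own orthogonal time slot) is an optimal transmission strategy for the weighted-sum receiver-side energy minimization problem (WSREMin). -/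
/-- Concavity of `x ↦ log (1 + x)` along the segment from `0`, in perspective form. -/
lemma mul_log_one_add_le_mul_log_one_add_div {s t x : ℝ} (hs : 0 ≤ s) (ht : 0 < t)
    (hst : s ≤ t) (hx : 0 ≤ x) :
    s * Real.log (1 + x) ≤ t * Real.log (1 + s * x / t) := by
  have hbern : (1 + x) ^ (s / t) ≤ 1 + s / t * x :=
    rpow_one_add_le_one_add_mul_self (by linarith) (by positivity)
      ((div_le_one ht).2 hst)
  have hlog : s / t * Real.log (1 + x) ≤ Real.log (1 + s * x / t) := by
    rw [← Real.log_rpow (by linarith), mul_div_right_comm]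
    exact Real.log_le_log (Real.rpow_pos_of_pos (by linarith) _) hbern
  calc s * Real.log (1 + x) = t * (s / t * Real.log (1 + x)) := by field_simp
    _ ≤ t * Real.log (1 + s * x / t) := by gcongr

/-- For every WSREMin-feasible tuple (T, ρ, p, t) there exists a
WSREMin-feasible tuple (T', ρ', p', t') whose time-sharing factors are equal
across subcarriers for each MT, whose on-times satisfy t'_k = T'·ρ'_{k,n}, and
whose weighted-sum receiver energy does not increase (optimality of D-TDMA for
WSREMin). -/
theorem dtdma_optimal_for_wsremin
    (K N : ℕ) (hK : 0 < K) (hN : 0 < N)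
    (a : ℝ) (ha : 0 < a)
    (f : Fin K → Fin N → ℝ) (hf : ∀ k n, 0 < f k n)
    (Q : Fin K → ℝ) (hQ : ∀ k, 0 < Q k)
    (Pavg : ℝ) (hPavg : 0 < Pavg)
    (Prc : ℝ) (hPrc : 0 < Prc)
    (α : Fin K → ℝ) (hα : ∀ k, 0 < α k)
    (T : ℝ) (ρ p : Fin K → Fin N → ℝ) (t : Fin K → ℝ)
    (hT : 0 < T)
    (hp : ∀ k n, 0 ≤ p k n)
    (hρ0 : ∀ k n, 0 ≤ ρ k n) (hρ1 : ∀ k n, ρ k n ≤ 1)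
    (hsum : ∀ n, ∑ k, ρ k n ≤ 1)
    (hdata : ∀ k, Q k ≤ ∑ n, T * ρ k n * (1 / a * Real.log (1 + f k n * p k n)))
    (hpow : ∑ k, ∑ n, ρ k n * p k n ≤ Pavg)
    (ht : ∀ k n, T * ρ k n ≤ t k) (htT : ∀ k, t k ≤ T) :
    ∃ (T' : ℝ) (ρ' p' : Fin K → Fin N → ℝ) (t' : Fin K → ℝ),
      0 < T' ∧
      (∀ k n, 0 ≤ p' k n) ∧
      (∀ k n, 0 ≤ ρ' k n) ∧ (∀ k n, ρ' k n ≤ 1) ∧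
      (∀ n, ∑ k, ρ' k n ≤ 1) ∧
      (∀ k, Q k ≤ ∑ n, T' * ρ' k n * (1 / a * Real.log (1 + f k n * p' k n))) ∧
      (∑ k, ∑ n, ρ' k n * p' k n ≤ Pavg) ∧
      (∀ k n, T' * ρ' k n ≤ t' k) ∧ (∀ k, t' k ≤ T') ∧
      (∀ k, ∀ n m : Fin N, ρ' k n = ρ' k m) ∧
      (∀ k n, t' k = T' * ρ' k n) ∧
      (∑ k, α k * Prc * t' k ≤ ∑ k, α k * Prc * t k) := by
  have htpos : ∀ k, 0 < t k := by
    intro k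
    by_contra! hk
    have hzero : ∀ n, T * ρ k n = 0 := fun n =>
      le_antisymm ((ht k n).trans hk) (mul_nonneg hT.le (hρ0 k n))
    have hQk := hdata k
    simp only [hzero, zero_mul, Finset.sum_const_zero] at hQk
    exact absurd (hQ k) hQk.not_gt
  -- The MTs are served one after the other, in slots of lengths `t k`, within a total time `S`.
  obtain ⟨S, hS⟩ : ∃ S, S = T + ∑ k, t k := ⟨_, rfl⟩
  have hsum_nonneg : 0 ≤ ∑ k, t k := Finset.sum_nonneg fun k _ => (htpos k).le
  have hTS : T ≤ S := by linarith
  have hSpos : 0 < S := hT.trans_le hTS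
  have hslot : ∀ k, S * (t k / S) = t k := fun k => mul_div_cancel₀ _ hSpos.ne'
  refine ⟨S, fun k _ => t k / S, fun k n => T * ρ k n * p k n / t k, t, hSpos,
    fun k n => ?_, fun k _ => (div_pos (htpos k) hSpos).le,
    fun k _ => (div_le_one hSpos).2 ((htT k).trans hTS), fun _ => ?_, fun k => ?_, ?_,
    fun k _ => (hslot k).le, fun k => (htT k).trans hTS, fun _ _ _ => rfl,
    fun k _ => (hslot k).symm, le_rfl⟩
  · exact div_nonneg (mul_nonneg (mul_nonneg hT.le (hρ0 k n)) (hp k n)) (htpos k).le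
  · rw [← Finset.sum_div, div_le_one hSpos]
    linarith
  · refine (hdata k).trans (Finset.sum_le_sum fun n _ => ?_)
    have hrate := mul_log_one_add_le_mul_log_one_add_div (mul_nonneg hT.le (hρ0 k n)) (htpos k)
      (ht k n) (mul_nonneg (hf k n).le (hp k n))
    have harg : f k n * (T * ρ k n * p k n / t k) = T * ρ k n * (f k n * p k n) / t k := by
      ring
    rw [hslot, harg, mul_left_comm, mul_left_comm (t k)]
    exact mul_le_mul_of_nonneg_left hrate (by positivity)
  · refine le_trans (Finset.sum_le_sum fun k _ => Finset.sum_le_sum fun n _ => ?_) hpow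
    have hpower : t k / S * (T * ρ k n * p k n / t k) = T / S * (ρ k n * p k n) := by
      have := (htpos k).ne'
      field_simp
    rw [hpower]
    exact mul_le_of_le_one_left (mul_nonneg (hρ0 k n) (hp k n)) ((div_le_one hSpos).2 hTS)
end

section
/- Suppose β > 0 and λ_1, …, λ_K > 0 satisfy β < (min_k α_k)·P_rc/P_avg and, for every k, the stationarity equation α_k·P_rc − β·P_avg + Σ_n u_{k,n}(β, λ_k) = 0. Define p*_{k,n} = max(λ_k/(a·β) − 1/f_{k,n}, 0) and t*_k = a·Q̄_k / Σ_n max(ln(λ_k·f_{k,n}/(a·β)), 0) (the denominator is positive under these hypotheses). Assume furthermore that the average power constraint is met with equality: Σ_kΣ_n t*_k·p*_{k,n} = P_avg·Σ_k t*_k. Then (p*, t*) is TDMA-feasible and it minimizes the weighted-sum receiver energy, i.e. Σ_k α_k·P_rc·t*_k ≤ Σ_k α_k·P_rc·t_k for every TDMA-feasible pair (p, t). -/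
/-- The water-filling power attains the rate `max (log (l * f / (a * β))) 0`. -/
lemma log_one_add_mul_waterfilling {a f β l : ℝ} (ha : 0 < a) (hf : 0 < f) (hβ : 0 < β)
    (hl : 0 < l) :
    Real.log (1 + f * max (l / (a * β) - 1 / f) 0) = max (Real.log (l * f / (a * β))) 0 := by
  have hx : 0 < l * f / (a * β) := by positivity
  have hmul : f * (l / (a * β) - 1 / f) = l * f / (a * β) - 1 := by
    field_simp
  rw [mul_max_of_nonneg _ _ hf.le, hmul, mul_zero]
  rcases le_total 1 (l * f / (a * β)) with h | h
  · rw [max_eq_left (by linarith), max_eq_left (Real.log_nonneg h)]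
    congr 1
    ring
  · rw [max_eq_right (by linarith), max_eq_right (Real.log_nonpos hx.le h)]
    simp

lemma max_sub_div_eq_mul_waterfilling {a f β l : ℝ} (hβ : 0 < β) :
    max (l / a - β / f) 0 = β * max (l / (a * β) - 1 / f) 0 := by
  rw [mul_max_of_nonneg _ _ hβ.le, mul_zero]
  congr 1
  field_simp

/-- Tangent bound for the logarithm over `1 ≤ y`, with the constraint possibly active. -/
lemma max_sub_mul_max_log_le {x y : ℝ} (hx : 0 < x) (hy : 1 ≤ y) :
    max (x - 1) 0 - x * max (Real.log x) 0 ≤ y - 1 - x * Real.log y := by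
  have hy0 : 0 < y := by linarith
  rcases le_total 1 x with h | h
  · rw [max_eq_left (by linarith), max_eq_left (Real.log_nonneg h)]
    have hlog := Real.log_le_sub_one_of_pos (div_pos hy0 hx)
    rw [Real.log_div hy0.ne' hx.ne'] at hlog
    have hmul := mul_le_mul_of_nonneg_left hlog hx.le
    have hcancel : x * (y / x - 1) = y - x := by field_simp
    linarith
  · rw [max_eq_right (by linarith), max_eq_right (Real.log_nonpos hx.le h)]
    have hlog := Real.log_le_sub_one_of_pos hy0
    have hmul := mul_le_mul_of_nonneg_right h (Real.log_nonneg hy)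
    linarith

/-- The water-filling power minimizes the Lagrangian `β p - (l / a) log (1 + f p)` over `p ≥ 0`. -/
lemma waterfilling_lagrangian_le {a f β l p : ℝ} (ha : 0 < a) (hf : 0 < f) (hβ : 0 < β)
    (hl : 0 < l) (hp : 0 ≤ p) :
    max (l / a - β / f) 0 - l / a * max (Real.log (l * f / (a * β))) 0
      ≤ β * p - l / a * Real.log (1 + f * p) := by
  have hbound := mul_le_mul_of_nonneg_left
    (max_sub_mul_max_log_le (x := l * f / (a * β)) (y := 1 + f * p) (by positivity)
      (by nlinarith [mul_nonneg hf.le hp])) (div_pos hβ hf).le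
  have hmax : β / f * max (l * f / (a * β) - 1) 0 = max (l / a - β / f) 0 := by
    rw [mul_max_of_nonneg _ _ (div_pos hβ hf).le, mul_zero]
    congr 1
    field_simp
  have hscale : β / f * (l * f / (a * β)) = l / a := by field_simp
  have hpower : β / f * (f * p) = β * p := by field_simp
  rw [mul_sub, mul_sub, hmax, ← mul_assoc, ← mul_assoc, hscale, add_sub_cancel_left, hpower]
    at hbound
  exact hbound

/-- If β > 0 and λ_k > 0 satisfy β < (min_k α_k)·P_rc/P_avg and the
stationarity equations, then the water-filling solution (p*, t*) of Theorem 1,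
provided the average power constraint is met with equality, is TDMA-feasible and
minimizes the weighted-sum receiver energy among all TDMA-feasible pairs. -/
theorem waterfilling_optimal_for_wsremin_tdma
    (K N : ℕ) (hK : 0 < K) (hN : 0 < N)
    (a : ℝ) (ha : 0 < a)
    (f : Fin K → Fin N → ℝ) (hf : ∀ k n, 0 < f k n)
    (Q : Fin K → ℝ) (hQ : ∀ k, 0 < Q k)
    (Pavg : ℝ) (hPavg : 0 < Pavg)
    (Prc : ℝ) (hPrc : 0 < Prc)
    (α : Fin K → ℝ) (hα : ∀ k, 0 < α k)
    (β : ℝ) (lam : Fin K → ℝ)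
    (hβ : 0 < β) (hlam : ∀ k, 0 < lam k)
    (hβlt : ∀ k, β < α k * Prc / Pavg)
    (hstat : ∀ k, α k * Prc - β * Pavg +
        ∑ n, (max (lam k / a - β / f k n) 0
          - lam k / a * max (Real.log (lam k * f k n / (a * β))) 0) = 0)
    (pstar : Fin K → Fin N → ℝ)
    (hpstar : ∀ k n, pstar k n = max (lam k / (a * β) - 1 / f k n) 0)
    (tstar : Fin K → ℝ)
    (htstar : ∀ k, tstar k =
        a * Q k / ∑ n, max (Real.log (lam k * f k n / (a * β))) 0)
    (heq : ∑ k, ∑ n, tstar k * pstar k n = Pavg * ∑ k, tstar k) :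
    (∀ k, 0 < ∑ n, max (Real.log (lam k * f k n / (a * β))) 0) ∧
    (∀ k n, 0 ≤ pstar k n) ∧
    (∀ k, 0 < tstar k) ∧
    (∀ k, Q k ≤ ∑ n, tstar k * (1 / a * Real.log (1 + f k n * pstar k n))) ∧
    (∑ k, ∑ n, tstar k * pstar k n ≤ Pavg * ∑ k, tstar k) ∧
    (∀ (p : Fin K → Fin N → ℝ) (t : Fin K → ℝ),
      (∀ k n, 0 ≤ p k n) →
      (∀ k, 0 < t k) →
      (∀ k, Q k ≤ ∑ n, t k * (1 / a * Real.log (1 + f k n * p k n))) →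
      (∑ k, ∑ n, t k * p k n ≤ Pavg * ∑ k, t k) →
      ∑ k, α k * Prc * tstar k ≤ ∑ k, α k * Prc * t k) := by
  have hpos : ∀ k, 0 < ∑ n, max (Real.log (lam k * f k n / (a * β))) 0 := by
    intro k
    have hstat_k := hstat k
    rw [Finset.sum_sub_distrib, ← Finset.mul_sum] at hstat_k
    have hgap := (lt_div_iff₀ hPavg).1 (hβlt k)
    have hnonneg : 0 ≤ ∑ n, max (lam k / a - β / f k n) 0 :=
      Finset.sum_nonneg fun n _ => le_max_right _ _
    have hprod : 0 < lam k / a * ∑ n, max (Real.log (lam k * f k n / (a * β))) 0 := by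
      linarith
    exact pos_of_mul_pos_right hprod (div_pos (hlam k) ha).le
  have htpos : ∀ k, 0 < tstar k := fun k => by
    rw [htstar k]
    exact div_pos (mul_pos ha (hQ k)) (hpos k)
  have htQ : ∀ k, tstar k * ∑ n, max (Real.log (lam k * f k n / (a * β))) 0 = a * Q k :=
    fun k => by rw [htstar k, div_mul_cancel₀ _ (hpos k).ne']
  refine ⟨hpos, fun k n => hpstar k n ▸ le_max_right _ _, htpos, ?_, heq.le, ?_⟩
  · intro k
    simp_rw [hpstar, log_one_add_mul_waterfilling ha (hf k _) hβ (hlam k), ← Finset.mul_sum]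
    rw [mul_left_comm, htQ k, ← mul_assoc, one_div_mul_cancel ha.ne', one_mul]
  · intro p t hp ht hrate hpow
    have hstar : ∀ k, α k * Prc * tstar k
        = β * (Pavg * tstar k) + lam k * Q k - β * ∑ n, tstar k * pstar k n := by
      intro k
      have hstat_k := hstat k
      simp_rw [max_sub_div_eq_mul_waterfilling hβ, ← hpstar] at hstat_k
      rw [Finset.sum_sub_distrib, ← Finset.mul_sum, ← Finset.mul_sum] at hstat_k
      have hlamQ : lam k / a * (a * Q k) = lam k * Q k := by field_simp
      rw [← Finset.mul_sum]
      linear_combination tstar k * hstat_k + lam k / a * htQ k + hlamQ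
    have hlower : ∀ k, β * (Pavg * t k) + lam k * Q k - β * ∑ n, t k * p k n
        ≤ α k * Prc * t k := by
      intro k
      have hlagr := Finset.sum_le_sum fun n (_ : n ∈ Finset.univ) =>
        waterfilling_lagrangian_le ha (hf k n) hβ (hlam k) (hp k n)
      rw [Finset.sum_sub_distrib (fun n => β * p k n), ← Finset.mul_sum, ← Finset.mul_sum]
        at hlagr
      have hscaled := mul_le_mul_of_nonneg_left
        (hlagr.trans' (by linarith [hstat k] : β * Pavg - α k * Prc ≤ _)) (ht k).le
      have hQ_k := mul_le_mul_of_nonneg_left (hrate k) (hlam k).le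
      rw [← Finset.mul_sum, ← Finset.mul_sum] at hQ_k
      rw [← Finset.mul_sum]
      have hrearrange : lam k * (t k * (1 / a * ∑ n, Real.log (1 + f k n * p k n)))
          = t k * (lam k / a * ∑ n, Real.log (1 + f k n * p k n)) := by ring
      linarith
    have hsum := Finset.sum_le_sum fun k (_ : k ∈ Finset.univ) => hlower k
    rw [Finset.sum_congr rfl fun k _ => hstar k]
    simp only [Finset.sum_sub_distrib, Finset.sum_add_distrib, ← Finset.mul_sum] at hsum heq hpow ⊢
    have hslack := mul_le_mul_of_nonneg_left hpow hβ.le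
    rw [heq]
    linarith
end

section
/- Fix a > 0, t > 0, β > 0, λ > 0, positive reals f_1, …, f_N, and α, P_rc, P_avg > 0. Then the infimum over s = (s_1, …, s_N) with each s_n ≥ 0 of the per-MT Lagrangian α·P_rc·t − λ·Σ_n s_n + β·Σ_n t·(exp(a·s_n/t) − 1)/f_n − β·P_avg·t equals (α·P_rc − β·P_avg + Σ_n u_n(β, λ))·t, where u_n(β, λ) := max(λ/a − β/f_n, 0) − (λ/a)·max(ln(λ·f_n/(a·β)), 0); moreover this infimum is attained at s_n = (t/a)·max(ln(λ·f_n/(a·β)), 0). -/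
/-- The function `x ↦ b (exp x - 1) - c x` takes the value `max (c - b) 0 - c max (log (c / b)) 0`
at `x = max (log (c / b)) 0`. -/
theorem mul_exp_sub_one_sub_mul_max_log {b c : ℝ} (hb : 0 < b) (hc : 0 < c) :
    b * (Real.exp (max (Real.log (c / b)) 0) - 1) - c * max (Real.log (c / b)) 0
      = max (c - b) 0 - c * max (Real.log (c / b)) 0 := by
  rcases le_total b c with h | h
  · rw [max_eq_left (Real.log_nonneg ((one_le_div hb).2 h)), max_eq_left (sub_nonneg.2 h),
      Real.exp_log (div_pos hc hb)]
    field_simp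
  · rw [max_eq_right (Real.log_nonpos (div_pos hc hb).le ((div_le_one hb).2 h)),
      max_eq_right (sub_nonpos.2 h)]
    simp

/-- The value `max (c - b) 0 - c max (log (c / b)) 0` bounds `b (exp x - 1) - c x` from below
on `x ≥ 0`. -/
theorem max_sub_mul_max_log_le_s6 {b c x : ℝ} (hb : 0 < b) (hc : 0 < c) (hx : 0 ≤ x) :
    max (c - b) 0 - c * max (Real.log (c / b)) 0 ≤ b * (Real.exp x - 1) - c * x := by
  rcases le_total b c with h | h
  · rw [max_eq_left (Real.log_nonneg ((one_le_div hb).2 h)), max_eq_left (sub_nonneg.2 h)]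
    have hexp : b * Real.exp x = c * Real.exp (x - Real.log (c / b)) := by
      rw [Real.exp_sub, Real.exp_log (div_pos hc hb)]
      field_simp
    have htangent := mul_le_mul_of_nonneg_left
      (Real.add_one_le_exp (x - Real.log (c / b))) hc.le
    linarith
  · rw [max_eq_right (Real.log_nonpos (div_pos hc hb).le ((div_le_one hb).2 h)),
      max_eq_right (sub_nonpos.2 h)]
    have htangent := mul_le_mul_of_nonneg_left (Real.add_one_le_exp x) hb.le
    have hslope := mul_le_mul_of_nonneg_right h hx
    linarith

/-- The Lagrangian in the scaled variables `x n = a * s n / t`. -/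
theorem lagrangian_eq_scaled {ι : Type*} [Fintype ι] {a t : ℝ} (ha : a ≠ 0) (ht : t ≠ 0)
    (β lam α Prc Pavg : ℝ) (f s : ι → ℝ) :
    α * Prc * t - lam * ∑ n, s n + β * ∑ n, t * (Real.exp (a * s n / t) - 1) / f n
        - β * Pavg * t
      = (α * Prc - β * Pavg +
          ∑ n, (β / f n * (Real.exp (a * s n / t) - 1) - lam / a * (a * s n / t))) * t := by
  have hlin : lam * ∑ n, s n = (∑ n, lam / a * (a * s n / t)) * t := by
    rw [Finset.mul_sum, Finset.sum_mul]
    refine Finset.sum_congr rfl fun n _ => ?_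
    field_simp
  have hexp : β * ∑ n, t * (Real.exp (a * s n / t) - 1) / f n
      = (∑ n, β / f n * (Real.exp (a * s n / t) - 1)) * t := by
    rw [Finset.mul_sum, Finset.sum_mul]
    refine Finset.sum_congr rfl fun n _ => ?_
    ring
  rw [hlin, hexp, Finset.sum_sub_distrib]
  ring

/-- The infimum over s with s_n ≥ 0 of the per-MT Lagrangian
α·P_rc·t − λ·Σ_n s_n + β·Σ_n t·(exp(a·s_n/t) − 1)/f_n − β·P_avg·t equals
(α·P_rc − β·P_avg + Σ_n u_n(β, λ))·t, attained at
s_n = (t/a)·max(ln(λ·f_n/(aβ)), 0). -/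
theorem per_mt_lagrangian_min
    (N : ℕ) (hN : 0 < N)
    (a t β lam α Prc Pavg : ℝ)
    (ha : 0 < a) (ht : 0 < t) (hβ : 0 < β) (hlam : 0 < lam)
    (hα : 0 < α) (hPrc : 0 < Prc) (hPavg : 0 < Pavg)
    (f : Fin N → ℝ) (hf : ∀ n, 0 < f n) :
    (∀ s : Fin N → ℝ, (∀ n, 0 ≤ s n) →
      (α * Prc - β * Pavg +
          ∑ n, (max (lam / a - β / f n) 0
            - lam / a * max (Real.log (lam * f n / (a * β))) 0)) * t
        ≤ α * Prc * t - lam * ∑ n, s n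
            + β * ∑ n, t * (Real.exp (a * s n / t) - 1) / f n - β * Pavg * t) ∧
    (α * Prc * t - lam * ∑ n, (t / a * max (Real.log (lam * f n / (a * β))) 0)
        + β * ∑ n, t * (Real.exp (a * (t / a * max (Real.log (lam * f n / (a * β))) 0) / t) - 1) / f n
        - β * Pavg * t
      = (α * Prc - β * Pavg +
          ∑ n, (max (lam / a - β / f n) 0
            - lam / a * max (Real.log (lam * f n / (a * β))) 0)) * t) := by
  have hratio : ∀ n, lam * f n / (a * β) = lam / a / (β / f n) := fun n => by
    rw [div_div_div_eq]
  have hb : ∀ n, 0 < β / f n := fun n => div_pos hβ (hf n)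
  have hc : 0 < lam / a := div_pos hlam ha
  simp only [hratio]
  refine ⟨fun s hs => ?_, ?_⟩
  · rw [lagrangian_eq_scaled ha.ne' ht.ne']
    refine mul_le_mul_of_nonneg_right ?_ ht.le
    refine add_le_add_right (Finset.sum_le_sum fun n _ => ?_) _
    exact max_sub_mul_max_log_le_s6 (hb n) hc (div_nonneg (mul_nonneg ha.le (hs n)) ht.le)
  · rw [lagrangian_eq_scaled ha.ne' ht.ne']
    congr 2
    refine Finset.sum_congr rfl fun n _ => ?_
    have hscale : ∀ x : ℝ, a * (t / a * x) / t = x := fun x => by field_simp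
    rw [hscale, mul_exp_sub_one_sub_mul_max_log (hb n) hc]
end

section
/- Suppose (p*, t*) is an optimal solution of problem (WSREMin-TDMA), i.e. (p*, t*) is TDMA-feasible and Σ_k α_k·P_rc·t*_k ≤ Σ_k α_k·P_rc·t_k for every TDMA-feasible pair (p, t). Then all data constraints and the average power constraint are met with equality: Σ_n t*_k·r_{k,n}(p*_{k,n}) = Q̄_k for every k, and Σ_kΣ_n t*_k·p*_{k,n} = P_avg·Σ_k t*_k. -/
open Filter Topology

/-- Bernoulli's inequality in logarithmic form. -/
lemma mul_log_one_add_le_log_one_add_mul {c x : ℝ} (hc₀ : 0 ≤ c) (hc₁ : c ≤ 1) (hx : 0 ≤ x) :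
    c * Real.log (1 + x) ≤ Real.log (1 + c * x) := by
  have hpos : 0 < 1 + x := by linarith
  rw [← Real.log_rpow hpos]
  exact Real.log_le_log (Real.rpow_pos_of_pos hpos c)
    (rpow_one_add_le_one_add_mul_self (by linarith) hc₀ hc₁)

/-- Finitely many strict inequalities `Q i < R i` survive scaling every `R i` by a common factor
`s < 1`. -/
lemma exists_common_scaling_lt_one {ι : Type*} [Finite ι] {Q R : ι → ℝ} (h : ∀ i, Q i < R i) :
    ∃ s : ℝ, 0 < s ∧ s < 1 ∧ ∀ i, Q i ≤ s * R i := by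
  have hev : ∀ i, ∀ᶠ s : ℝ in 𝓝[<] 1, Q i < s * R i := fun i => by
    have ht : Tendsto (fun s : ℝ => s * R i) (𝓝 1) (𝓝 (1 * R i)) :=
      tendsto_id.mul_const (R i)
    exact (ht.eventually_const_lt (by simpa using h i)).filter_mono nhdsWithin_le_nhds
  have hpos : ∀ᶠ s : ℝ in 𝓝[<] 1, 0 < s :=
    (lt_mem_nhds zero_lt_one).filter_mono nhdsWithin_le_nhds
  obtain ⟨s, ⟨hs, hs₀⟩, hs₁⟩ :=
    (((eventually_all.2 hev).and hpos).and eventually_mem_nhdsWithin).exists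
  exact ⟨s, hs₀, hs₁, fun i => (hs i).le⟩

/-- If the average power constraint is slack, raising all powers slightly allows all transmission
times to be shortened by a common factor `s < 1`. -/
lemma exists_shorter_feasible_of_power_slack {κ ν : Type*} [Fintype κ] [Fintype ν] [Nonempty ν]
    {a : ℝ} (ha : 0 < a) {f : κ → ν → ℝ} (hf : ∀ k n, 0 < f k n) {Q : κ → ℝ} {Pavg : ℝ}
    {p : κ → ν → ℝ} {t : κ → ℝ} (hp : ∀ k n, 0 ≤ p k n) (ht : ∀ k, 0 < t k)
    (hdata : ∀ k, Q k ≤ ∑ n, t k * (1 / a * Real.log (1 + f k n * p k n)))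
    (hpow : ∑ k, ∑ n, t k * p k n < Pavg * ∑ k, t k) :
    ∃ (s : ℝ) (p' : κ → ν → ℝ), 0 < s ∧ s < 1 ∧ (∀ k n, 0 ≤ p' k n) ∧
      (∀ k, Q k ≤ ∑ n, s * t k * (1 / a * Real.log (1 + f k n * p' k n))) ∧
      ∑ k, ∑ n, s * t k * p' k n ≤ Pavg * ∑ k, s * t k := by
  obtain ⟨δ, hδpow, hδ⟩ : ∃ δ : ℝ, ∑ k, ∑ n, t k * (p k n + δ) < Pavg * ∑ k, t k ∧ 0 < δ := by
    have hcont : Continuous fun δ : ℝ => ∑ k, ∑ n, t k * (p k n + δ) := by fun_prop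
    have hev : ∀ᶠ δ : ℝ in 𝓝[>] 0, ∑ k, ∑ n, t k * (p k n + δ) < Pavg * ∑ k, t k :=
      ((hcont.tendsto 0).eventually_lt_const (by simpa using hpow)).filter_mono
        nhdsWithin_le_nhds
    exact (hev.and eventually_mem_nhdsWithin).exists
  have hrate : ∀ k, Q k < ∑ n, t k * (1 / a * Real.log (1 + f k n * (p k n + δ))) := fun k => by
    refine (hdata k).trans_lt (Finset.sum_lt_sum_of_nonempty Finset.univ_nonempty fun n _ => ?_)
    have hfp := mul_nonneg (hf k n).le (hp k n)
    have hfδ := mul_pos (hf k n) hδ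
    have hlog : Real.log (1 + f k n * p k n) < Real.log (1 + f k n * (p k n + δ)) :=
      Real.log_lt_log (by linarith) (by linarith)
    exact mul_lt_mul_of_pos_left (mul_lt_mul_of_pos_left hlog (by positivity)) (ht k)
  obtain ⟨s, hs₀, hs₁, hs⟩ := exists_common_scaling_lt_one hrate
  refine ⟨s, fun k n => p k n + δ, hs₀, hs₁, fun k n => add_nonneg (hp k n) hδ.le, fun k => ?_, ?_⟩
  · simpa only [Finset.mul_sum, mul_assoc] using hs k
  · calc ∑ k, ∑ n, s * t k * (p k n + δ) = s * ∑ k, ∑ n, t k * (p k n + δ) := by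
          simp only [Finset.mul_sum, mul_assoc]
      _ ≤ s * (Pavg * ∑ k, t k) := mul_le_mul_of_nonneg_left hδpow.le hs₀.le
      _ = Pavg * ∑ k, s * t k := by rw [← Finset.mul_sum, mul_left_comm]

/-- If the data constraint of one terminal is slack, its powers can be scaled down so that all data
constraints still hold and the total transmit energy strictly decreases. -/
lemma exists_lower_power_of_data_slack {κ ν : Type*} [Fintype κ] [Fintype ν]
    {a : ℝ} (ha : 0 < a) {f : κ → ν → ℝ} (hf : ∀ k n, 0 < f k n)
    {Q : κ → ℝ} (hQ : ∀ k, 0 < Q k)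
    {p : κ → ν → ℝ} {t : κ → ℝ} (hp : ∀ k n, 0 ≤ p k n) (ht : ∀ k, 0 < t k)
    (hdata : ∀ k, Q k ≤ ∑ n, t k * (1 / a * Real.log (1 + f k n * p k n)))
    {j : κ} (hj : Q j < ∑ n, t j * (1 / a * Real.log (1 + f j n * p j n))) :
    ∃ p' : κ → ν → ℝ, (∀ k n, 0 ≤ p' k n) ∧
      (∀ k, Q k ≤ ∑ n, t k * (1 / a * Real.log (1 + f k n * p' k n))) ∧
      ∑ k, ∑ n, t k * p' k n < ∑ k, ∑ n, t k * p k n := by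
  classical
  set R := ∑ n, t j * (1 / a * Real.log (1 + f j n * p j n)) with hR
  have hRpos : 0 < R := (hQ j).trans hj
  set c := Q j / R
  have hc₀ : 0 < c := div_pos (hQ j) hRpos
  have hc₁ : c < 1 := (div_lt_one hRpos).2 hj
  obtain ⟨m, hm⟩ : ∃ m, 0 < p j m := by
    by_contra! h
    have hzero : ∀ n, p j n = 0 := fun n => le_antisymm (h n) (hp j n)
    simp [hR, hzero] at hRpos
  have hle : ∀ k n, (if k = j then c * p k n else p k n) ≤ p k n := fun k n => by
    split_ifs
    · exact mul_le_of_le_one_left (hp k n) hc₁.le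
    · exact le_rfl
  refine ⟨fun k n => if k = j then c * p k n else p k n, fun k n => ?_, fun k => ?_, ?_⟩
  · dsimp only
    split_ifs
    · exact mul_nonneg hc₀.le (hp k n)
    · exact hp k n
  · rcases eq_or_ne k j with rfl | hkj
    · simp only [if_true]
      calc Q k = c * R := (div_mul_cancel₀ _ hRpos.ne').symm
        _ = ∑ n, t k * (1 / a * (c * Real.log (1 + f k n * p k n))) := by
          rw [hR, Finset.mul_sum]
          exact Finset.sum_congr rfl fun n _ => by ring
        _ ≤ ∑ n, t k * (1 / a * Real.log (1 + f k n * (c * p k n))) := by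
          refine Finset.sum_le_sum fun n _ => mul_le_mul_of_nonneg_left
            (mul_le_mul_of_nonneg_left ?_ (by positivity)) (ht k).le
          rw [mul_left_comm (f k n)]
          exact mul_log_one_add_le_log_one_add_mul hc₀.le hc₁.le
            (mul_nonneg (hf k n).le (hp k n))
    · simpa only [if_neg hkj] using hdata k
  · have hterm : ∀ k n, t k * (if k = j then c * p k n else p k n) ≤ t k * p k n := fun k n =>
      mul_le_mul_of_nonneg_left (hle k n) (ht k).le
    refine Finset.sum_lt_sum (fun k _ => Finset.sum_le_sum fun n _ => hterm k n)
      ⟨j, Finset.mem_univ j, Finset.sum_lt_sum (fun n _ => hterm j n) ⟨m, Finset.mem_univ m, ?_⟩⟩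
    simp only [if_true]
    exact mul_lt_mul_of_pos_left (mul_lt_of_lt_one_left hm hc₁) (ht j)

/-- At any optimal solution (p*, t*) of (WSREMin-TDMA), all data
constraints and the average power constraint are met with equality. -/
theorem wsremin_tdma_constraints_tight
    (K N : ℕ) (hK : 0 < K) (hN : 0 < N)
    (a : ℝ) (ha : 0 < a)
    (f : Fin K → Fin N → ℝ) (hf : ∀ k n, 0 < f k n)
    (Q : Fin K → ℝ) (hQ : ∀ k, 0 < Q k)
    (Pavg : ℝ) (hPavg : 0 < Pavg)
    (Prc : ℝ) (hPrc : 0 < Prc)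
    (α : Fin K → ℝ) (hα : ∀ k, 0 < α k)
    (pstar : Fin K → Fin N → ℝ) (tstar : Fin K → ℝ)
    (hp : ∀ k n, 0 ≤ pstar k n)
    (ht : ∀ k, 0 < tstar k)
    (hdata : ∀ k, Q k ≤ ∑ n, tstar k * (1 / a * Real.log (1 + f k n * pstar k n)))
    (hpow : ∑ k, ∑ n, tstar k * pstar k n ≤ Pavg * ∑ k, tstar k)
    (hopt : ∀ (p : Fin K → Fin N → ℝ) (t : Fin K → ℝ),
      (∀ k n, 0 ≤ p k n) →
      (∀ k, 0 < t k) →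
      (∀ k, Q k ≤ ∑ n, t k * (1 / a * Real.log (1 + f k n * p k n))) →
      (∑ k, ∑ n, t k * p k n ≤ Pavg * ∑ k, t k) →
      ∑ k, α k * Prc * tstar k ≤ ∑ k, α k * Prc * t k) :
    (∀ k, ∑ n, tstar k * (1 / a * Real.log (1 + f k n * pstar k n)) = Q k) ∧
    (∑ k, ∑ n, tstar k * pstar k n = Pavg * ∑ k, tstar k) := by
  have : Nonempty (Fin K) := ⟨⟨0, hK⟩⟩
  have : Nonempty (Fin N) := ⟨⟨0, hN⟩⟩
  have hcost : 0 < ∑ k, α k * Prc * tstar k :=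
    Finset.sum_pos (fun k _ => mul_pos (mul_pos (hα k) hPrc) (ht k)) Finset.univ_nonempty
  have hnoslack : ∀ p : Fin K → Fin N → ℝ, (∀ k n, 0 ≤ p k n) →
      (∀ k, Q k ≤ ∑ n, tstar k * (1 / a * Real.log (1 + f k n * p k n))) →
      ¬ ∑ k, ∑ n, tstar k * p k n < Pavg * ∑ k, tstar k := by
    intro p hp' hdata' hslack
    obtain ⟨s, q, hs₀, hs₁, hq, hqdata, hqpow⟩ :=
      exists_shorter_feasible_of_power_slack ha hf hp' ht hdata' hslack
    have hle := hopt q (fun k => s * tstar k) hq (fun k => mul_pos hs₀ (ht k)) hqdata hqpow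
    have hscale : ∑ k, α k * Prc * (s * tstar k) = s * ∑ k, α k * Prc * tstar k := by
      rw [Finset.mul_sum]
      exact Finset.sum_congr rfl fun k _ => by ring
    rw [hscale] at hle
    exact (mul_lt_of_lt_one_left hcost hs₁).not_ge hle
  refine ⟨fun k => (hdata k).antisymm' (not_lt.1 fun hk => ?_),
    hpow.antisymm (not_lt.1 (hnoslack pstar hp hdata))⟩
  obtain ⟨q, hq, hqdata, hqpow⟩ := exists_lower_power_of_data_slack ha hf hQ hp ht hdata hk
  exact hnoslack q hq hqdata (hqpow.trans_le hpow)
end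

section
/- Assume that for every T > 0 the infimum defining v(T) is attained. Then the optimal value of problem (TEMin), namely the infimum of T·Σ_kΣ_n ρ_{k,n}·p_{k,n} + T·P_tc over all T > 0, p_{k,n} ≥ 0 and 0 ≤ ρ_{k,n} ≤ 1 satisfying Σ_k ρ_{k,n} ≤ 1 for every n, Σ_n T·ρ_{k,n}·r_{k,n}(p_{k,n}) ≥ Q̄_k for every k, and Σ_kΣ_n ρ_{k,n}·p_{k,n} ≤ P_avg, equals the infimum of T·v(T) + T·P_tc over the set {T > 0 : v(T) ≤ P_avg}. -/
/-- A bounded below set and a coinitial subset of it have the same infimum. -/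
theorem csInf_eq_csInf_of_subset_of_forall_exists_le {α : Type*}
    [ConditionallyCompleteLattice α] {s t : Set α} (hs : BddBelow s) (hts : t ⊆ s)
    (hst : ∀ x ∈ s, ∃ y ∈ t, y ≤ x) : sInf s = sInf t := by
  rcases s.eq_empty_or_nonempty with rfl | hne
  · rw [Set.subset_empty_iff.mp hts]
  · have htne : t.Nonempty := by
      obtain ⟨x, hx⟩ := hne
      obtain ⟨y, hy, -⟩ := hst x hx
      exact ⟨y, hy⟩
    refine le_antisymm (csInf_le_csInf hs htne hts) (le_csInf hne fun x hx => ?_)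
    obtain ⟨y, hy, hyx⟩ := hst x hx
    exact (csInf_le (hs.mono hts) hy).trans hyx

/-- Scaling a rate requirement by the transmission time. -/
theorem div_le_sum_iff_le_sum_mul {ι : Type*} [Fintype ι] {T : ℝ} (hT : 0 < T) (q : ℝ)
    (w r : ι → ℝ) : q / T ≤ ∑ n, w n * r n ↔ q ≤ ∑ n, T * w n * r n := by
  simp_rw [mul_assoc, ← Finset.mul_sum]
  exact div_le_iff₀' hT

/-- Assuming the infimum defining v(T) is attained for every T > 0,
the optimal value of problem (TEMin) equals the infimum of T·v(T) + T·P_tc over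
{T > 0 : v(T) ≤ P_avg}. -/
theorem temin_decomposition
    (K N : ℕ) (hK : 0 < K) (hN : 0 < N)
    (a : ℝ) (ha : 0 < a)
    (f : Fin K → Fin N → ℝ) (hf : ∀ k n, 0 < f k n)
    (Q : Fin K → ℝ) (hQ : ∀ k, 0 < Q k)
    (Pavg : ℝ) (hPavg : 0 < Pavg)
    (Ptc : ℝ) (hPtc : 0 < Ptc)
    (v : ℝ → ℝ)
    (hv : ∀ T : ℝ, 0 < T →
      IsLeast {P : ℝ | ∃ p ρ : Fin K → Fin N → ℝ,
        (∀ k n, 0 ≤ p k n) ∧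
        (∀ k n, 0 ≤ ρ k n ∧ ρ k n ≤ 1) ∧
        (∀ n, ∑ k, ρ k n ≤ 1) ∧
        (∀ k, Q k / T ≤ ∑ n, ρ k n * (1 / a * Real.log (1 + f k n * p k n))) ∧
        P = ∑ k, ∑ n, ρ k n * p k n} (v T)) :
    sInf {E : ℝ | ∃ (T : ℝ) (p ρ : Fin K → Fin N → ℝ),
        0 < T ∧
        (∀ k n, 0 ≤ p k n) ∧
        (∀ k n, 0 ≤ ρ k n ∧ ρ k n ≤ 1) ∧
        (∀ n, ∑ k, ρ k n ≤ 1) ∧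
        (∀ k, Q k ≤ ∑ n, T * ρ k n * (1 / a * Real.log (1 + f k n * p k n))) ∧
        (∑ k, ∑ n, ρ k n * p k n ≤ Pavg) ∧
        E = T * ∑ k, ∑ n, ρ k n * p k n + T * Ptc}
    = sInf {E : ℝ | ∃ T : ℝ, 0 < T ∧ v T ≤ Pavg ∧ E = T * v T + T * Ptc} := by
  apply csInf_eq_csInf_of_subset_of_forall_exists_le
  · refine ⟨0, ?_⟩
    rintro _ ⟨T, p, ρ, hT, hp, hρ, -, -, -, rfl⟩
    have hsum : 0 ≤ ∑ k, ∑ n, ρ k n * p k n :=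
      Finset.sum_nonneg fun k _ => Finset.sum_nonneg fun n _ => mul_nonneg (hρ k n).1 (hp k n)
    positivity
  · rintro _ ⟨T, hT, hvT, rfl⟩
    obtain ⟨p, ρ, hp, hρ, hρsum, hrate, hval⟩ := (hv T hT).1
    exact ⟨T, p, ρ, hT, hp, hρ, hρsum,
      fun k => (div_le_sum_iff_le_sum_mul hT _ _ _).mp (hrate k), hval ▸ hvT, by rw [hval]⟩
  · rintro _ ⟨T, p, ρ, hT, hp, hρ, hρsum, hrate, hpow, rfl⟩
    have hle : v T ≤ ∑ k, ∑ n, ρ k n * p k n :=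
      (hv T hT).2 ⟨p, ρ, hp, hρ, hρsum,
        fun k => (div_le_sum_iff_le_sum_mul hT _ _ _).mpr (hrate k), rfl⟩
    refine ⟨T * v T + T * Ptc, ⟨T, hT, hle.trans hpow, rfl⟩, ?_⟩
    gcongr
end

section
/- The function v, assigning to each T > 0 the minimum average transmit power v(T) of problem (TEMin-1), is convex on (0, ∞): for every T_1, T_2 > 0 and θ ∈ (0, 1), v(θ·T_1 + (1−θ)·T_2) ≤ θ·v(T_1) + (1−θ)·v(T_2). -/
/-- Time sharing: two powers used with weights `α` and `β` can be replaced by a single power with the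
same total energy and at least the same total rate. -/
lemma exists_power_of_time_sharing {c α β x y : ℝ} (hc : 0 < c) (hα : 0 ≤ α) (hβ : 0 ≤ β)
    (hx : 0 ≤ x) (hy : 0 ≤ y) :
    ∃ p : ℝ, 0 ≤ p ∧ (α + β) * p = α * x + β * y ∧
      α * Real.log (1 + c * x) + β * Real.log (1 + c * y) ≤
        (α + β) * Real.log (1 + c * p) := by
  rcases (add_nonneg hα hβ).eq_or_lt with h | h
  · obtain rfl : α = 0 := by linarith
    obtain rfl : β = 0 := by linarith
    exact ⟨0, by simp⟩
  · refine ⟨(α * x + β * y) / (α + β), by positivity, by field_simp, ?_⟩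
    have hconc := strictConcaveOn_log_Ioi.concaveOn.2
      (show 1 + c * x ∈ Set.Ioi (0 : ℝ) from Set.mem_Ioi.2 (by positivity))
      (show 1 + c * y ∈ Set.Ioi (0 : ℝ) from Set.mem_Ioi.2 (by positivity))
      (show 0 ≤ α / (α + β) by positivity) (show 0 ≤ β / (α + β) by positivity)
      (by field_simp)
    simp only [smul_eq_mul] at hconc
    have harg : α / (α + β) * (1 + c * x) + β / (α + β) * (1 + c * y) =
        1 + c * ((α * x + β * y) / (α + β)) := by
      field_simp
      ring
    rw [harg] at hconc
    calc α * Real.log (1 + c * x) + β * Real.log (1 + c * y)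
        = (α + β) * (α / (α + β) * Real.log (1 + c * x) +
            β / (α + β) * Real.log (1 + c * y)) := by field_simp
      _ ≤ _ := mul_le_mul_of_nonneg_left hconc h.le

/-- The inverse is convex on the positive reals. -/
lemma div_convex_combination_le {q s t θ : ℝ} (hq : 0 ≤ q) (hs : 0 < s) (ht : 0 < t)
    (hθ : 0 ≤ θ) (hθ' : 0 ≤ 1 - θ) :
    q / (θ * s + (1 - θ) * t) ≤ θ * (q / s) + (1 - θ) * (q / t) := by
  have h := (convexOn_zpow (𝕜 := ℝ) (-1)).2 (Set.mem_Ioi.2 hs) (Set.mem_Ioi.2 ht) hθ hθ' (by ring)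
  simp only [smul_eq_mul, zpow_neg_one] at h
  have h' := mul_le_mul_of_nonneg_left h hq
  simp only [div_eq_mul_inv]
  linarith

/-- The average powers attained by the feasible points with rate targets `R`. -/
def feasiblePowers {K N : ℕ} (a : ℝ) (f : Fin K → Fin N → ℝ) (R : Fin K → ℝ) : Set ℝ :=
  {P : ℝ | ∃ p ρ : Fin K → Fin N → ℝ,
    (∀ k n, 0 ≤ p k n) ∧
    (∀ k n, 0 ≤ ρ k n ∧ ρ k n ≤ 1) ∧
    (∀ n, ∑ k, ρ k n ≤ 1) ∧
    (∀ k, R k ≤ ∑ n, ρ k n * (1 / a * Real.log (1 + f k n * p k n))) ∧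
    P = ∑ k, ∑ n, ρ k n * p k n}

lemma feasiblePowers_bddBelow {K N : ℕ} (a : ℝ) (f : Fin K → Fin N → ℝ) (R : Fin K → ℝ) :
    BddBelow (feasiblePowers a f R) := by
  refine ⟨0, ?_⟩
  rintro P ⟨p, ρ, hp, hρ, -, -, rfl⟩
  exact Finset.sum_nonneg fun k _ => Finset.sum_nonneg fun n _ => mul_nonneg (hρ k n).1 (hp k n)

/-- Equal sharing of every subcarrier meets any rate targets. -/
lemma feasiblePowers_nonempty {K N : ℕ} (hK : 0 < K) (hN : 0 < N) {a : ℝ} (ha : 0 < a)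
    {f : Fin K → Fin N → ℝ} (hf : ∀ k n, 0 < f k n) {R : Fin K → ℝ} (hR : ∀ k, 0 ≤ R k) :
    (feasiblePowers a f R).Nonempty := by
  have hK' : (1 : ℝ) ≤ K := by exact_mod_cast hK
  have hN' : (1 : ℝ) ≤ N := by exact_mod_cast hN
  refine ⟨_, fun k n => (Real.exp (a * K * R k) - 1) / f k n, fun _ _ => 1 / K,
    fun k n => ?_, fun k n => ⟨by positivity, ?_⟩, fun n => ?_, fun k => ?_, rfl⟩
  · have : 0 ≤ a * K * R k := mul_nonneg (by positivity) (hR k)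
    exact div_nonneg (sub_nonneg.2 (Real.one_le_exp this)) (hf k n).le
  · rw [div_le_one (by positivity)]
    exact hK'
  · simp only [Finset.sum_const, Finset.card_univ, Fintype.card_fin, nsmul_eq_mul]
    exact (mul_one_div_cancel (by positivity)).le
  · have hterm : ∀ n, 1 / (K : ℝ) * (1 / a * Real.log (1 + f k n *
        ((Real.exp (a * K * R k) - 1) / f k n))) = R k := fun n => by
      rw [mul_div_cancel₀ _ (hf k n).ne', add_sub_cancel, Real.log_exp]
      field_simp
    simp only [hterm, Finset.sum_const, Finset.card_univ, Fintype.card_fin, nsmul_eq_mul]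
    exact le_mul_of_one_le_left (hR k) hN'

/-- Convex combinations of attained powers are attained at any rate targets dominated by the
convex combination of the rate targets. -/
lemma feasiblePowers_combination {K N : ℕ} {a : ℝ} (ha : 0 < a)
    {f : Fin K → Fin N → ℝ} (hf : ∀ k n, 0 < f k n) {R R₁ R₂ : Fin K → ℝ} {θ : ℝ}
    (hθ : 0 ≤ θ) (hθ' : 0 ≤ 1 - θ) (hR : ∀ k, R k ≤ θ * R₁ k + (1 - θ) * R₂ k)
    {P₁ P₂ : ℝ} (h₁ : P₁ ∈ feasiblePowers a f R₁) (h₂ : P₂ ∈ feasiblePowers a f R₂) :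
    θ * P₁ + (1 - θ) * P₂ ∈ feasiblePowers a f R := by
  obtain ⟨p₁, ρ₁, hp₁, hρ₁, hs₁, hr₁, rfl⟩ := h₁
  obtain ⟨p₂, ρ₂, hp₂, hρ₂, hs₂, hr₂, rfl⟩ := h₂
  choose p hp hpower hrate using fun k n => exists_power_of_time_sharing (hf k n)
    (mul_nonneg hθ (hρ₁ k n).1) (mul_nonneg hθ' (hρ₂ k n).1) (hp₁ k n) (hp₂ k n)
  refine ⟨p, fun k n => θ * ρ₁ k n + (1 - θ) * ρ₂ k n, hp, fun k n => ⟨?_, ?_⟩, fun n => ?_,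
    fun k => ?_, ?_⟩
  · exact add_nonneg (mul_nonneg hθ (hρ₁ k n).1) (mul_nonneg hθ' (hρ₂ k n).1)
  · nlinarith [(hρ₁ k n).2, (hρ₂ k n).2]
  · rw [Finset.sum_add_distrib, ← Finset.mul_sum, ← Finset.mul_sum]
    nlinarith [hs₁ n, hs₂ n]
  · refine (hR k).trans ((add_le_add (mul_le_mul_of_nonneg_left (hr₁ k) hθ)
      (mul_le_mul_of_nonneg_left (hr₂ k) hθ')).trans ?_)
    rw [Finset.mul_sum, Finset.mul_sum, ← Finset.sum_add_distrib]
    refine Finset.sum_le_sum fun n _ => ?_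
    have := mul_le_mul_of_nonneg_left (hrate k n) (one_div_pos.2 ha).le
    linarith
  · simp only [hpower, Finset.mul_sum, Finset.sum_add_distrib, mul_assoc]

/-- The minimum average transmit power v(T) of problem (TEMin-1)
is a convex function of T on (0, ∞). -/
theorem v_convex
    (K N : ℕ) (hK : 0 < K) (hN : 0 < N)
    (a : ℝ) (ha : 0 < a)
    (f : Fin K → Fin N → ℝ) (hf : ∀ k n, 0 < f k n)
    (Q : Fin K → ℝ) (hQ : ∀ k, 0 < Q k)
    (v : ℝ → ℝ)
    (hv : ∀ T : ℝ, 0 < T →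
      v T = sInf {P : ℝ | ∃ p ρ : Fin K → Fin N → ℝ,
        (∀ k n, 0 ≤ p k n) ∧
        (∀ k n, 0 ≤ ρ k n ∧ ρ k n ≤ 1) ∧
        (∀ n, ∑ k, ρ k n ≤ 1) ∧
        (∀ k, Q k / T ≤ ∑ n, ρ k n * (1 / a * Real.log (1 + f k n * p k n))) ∧
        P = ∑ k, ∑ n, ρ k n * p k n}) :
    ∀ T₁ T₂ θ : ℝ, 0 < T₁ → 0 < T₂ → 0 < θ → θ < 1 →
      v (θ * T₁ + (1 - θ) * T₂) ≤ θ * v T₁ + (1 - θ) * v T₂ := by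
  intro T₁ T₂ θ hT₁ hT₂ hθ hθ1
  have hθ' : 0 < 1 - θ := sub_pos.2 hθ1
  have hv' : ∀ T : ℝ, 0 < T → v T = sInf (feasiblePowers a f fun k => Q k / T) := hv
  have hne : ∀ T : ℝ, 0 < T → (feasiblePowers a f fun k => Q k / T).Nonempty := fun T hT =>
    feasiblePowers_nonempty hK hN ha hf fun k => (div_pos (hQ k) hT).le
  rw [hv' _ (add_pos (mul_pos hθ hT₁) (mul_pos hθ' hT₂)), hv' T₁ hT₁, hv' T₂ hT₂]
  refine le_of_forall_pos_lt_add fun ε hε => ?_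
  obtain ⟨P₁, hP₁, hlt₁⟩ := Real.lt_sInf_add_pos (hne T₁ hT₁) hε
  obtain ⟨P₂, hP₂, hlt₂⟩ := Real.lt_sInf_add_pos (hne T₂ hT₂) hε
  refine (csInf_le (feasiblePowers_bddBelow a f _) (feasiblePowers_combination ha hf hθ.le hθ'.le
    (fun k => div_convex_combination_le (hQ k).le hT₁ hT₂ hθ.le hθ'.le) hP₁ hP₂)).trans_lt ?_
  linarith [mul_lt_mul_of_pos_left hlt₁ hθ, mul_lt_mul_of_pos_left hlt₂ hθ']
end

section
/- The function T ↦ T·v(T) is convex on (0, ∞); consequently, for any constant P_tc ≥ 0, the objective T ↦ T·v(T) + T·P_tc of problem (TEMin-2) is convex on (0, ∞), i.e. problem (TEMin-2) is a convex optimization problem. -/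
/-- The total powers achieved by time-sharing allocations whose rates meet the demands `q`. -/
def achievablePowers {K N : ℕ} (a : ℝ) (f : Fin K → Fin N → ℝ) (q : Fin K → ℝ) : Set ℝ :=
  {P : ℝ | ∃ p ρ : Fin K → Fin N → ℝ,
    (∀ k n, 0 ≤ p k n) ∧
    (∀ k n, 0 ≤ ρ k n ∧ ρ k n ≤ 1) ∧
    (∀ n, ∑ k, ρ k n ≤ 1) ∧
    (∀ k, q k ≤ ∑ n, ρ k n * (1 / a * Real.log (1 + f k n * p k n))) ∧
    P = ∑ k, ∑ n, ρ k n * p k n}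

/-- Joint concavity of the perspective `(ρ, ρ p) ↦ ρ log (1 + c p)`, including at `ρ = 0`. -/
lemma exists_perspective_log_ge {c α β p q : ℝ} (hc : 0 ≤ c) (hα : 0 ≤ α) (hβ : 0 ≤ β)
    (hp : 0 ≤ p) (hq : 0 ≤ q) :
    ∃ r, 0 ≤ r ∧ (α + β) * r = α * p + β * q ∧
      α * Real.log (1 + c * p) + β * Real.log (1 + c * q) ≤ (α + β) * Real.log (1 + c * r) := by
  rcases (add_nonneg hα hβ).eq_or_lt with h | h
  · obtain rfl : α = 0 := by linarith
    obtain rfl : β = 0 := by linarith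
    exact ⟨0, le_rfl, by simp, by simp⟩
  · refine ⟨(α * p + β * q) / (α + β), by positivity, by field_simp, ?_⟩
    have hlog := strictConcaveOn_log_Ioi.concaveOn.2
      (show 1 + c * p ∈ Set.Ioi (0 : ℝ) from Set.mem_Ioi.2 (by positivity))
      (show 1 + c * q ∈ Set.Ioi (0 : ℝ) from Set.mem_Ioi.2 (by positivity))
      (div_nonneg hα h.le) (div_nonneg hβ h.le) (by field_simp)
    simp only [smul_eq_mul] at hlog
    have hmean : α / (α + β) * (1 + c * p) + β / (α + β) * (1 + c * q)
        = 1 + c * ((α * p + β * q) / (α + β)) := by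
      field_simp
      ring
    rw [hmean] at hlog
    calc α * Real.log (1 + c * p) + β * Real.log (1 + c * q)
        = (α + β) * (α / (α + β) * Real.log (1 + c * p)
            + β / (α + β) * Real.log (1 + c * q)) := by field_simp
      _ ≤ _ := mul_le_mul_of_nonneg_left hlog h.le

lemma bddBelow_achievablePowers {K N : ℕ} (a : ℝ) (f : Fin K → Fin N → ℝ) (q : Fin K → ℝ) :
    BddBelow (achievablePowers a f q) := by
  refine ⟨0, ?_⟩
  rintro P ⟨p, ρ, hp, hρ, -, -, rfl⟩
  exact Finset.sum_nonneg fun k _ => Finset.sum_nonneg fun n _ => mul_nonneg (hρ k n).1 (hp k n)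

lemma achievablePowers_nonempty {K N : ℕ} (hK : 0 < K) (hN : 0 < N) {a : ℝ} (ha : 0 < a)
    {f : Fin K → Fin N → ℝ} (hf : ∀ k n, 0 < f k n) {q : Fin K → ℝ} (hq : ∀ k, 0 ≤ q k) :
    (achievablePowers a f q).Nonempty := by
  have hK' : (1 : ℝ) ≤ K := by exact_mod_cast hK
  have hN' : (1 : ℝ) ≤ N := by exact_mod_cast hN
  refine ⟨_, fun k n => (Real.exp (a * K * q k) - 1) / f k n, fun _ _ => 1 / K,
    fun k n => ?_, fun k n => ⟨by positivity, ?_⟩, fun n => ?_, fun k => ?_, rfl⟩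
  · have hexp : 0 ≤ a * K * q k := mul_nonneg (by positivity) (hq k)
    exact div_nonneg (sub_nonneg.2 (Real.one_le_exp hexp)) (hf k n).le
  · exact (div_le_one (by linarith)).2 hK'
  · have : (K : ℝ) ≠ 0 := by positivity
    simp [this]
  · have hrate : ∀ n, 1 / (K : ℝ) * (1 / a * Real.log
        (1 + f k n * ((Real.exp (a * K * q k) - 1) / f k n))) = q k := by
      intro n
      rw [mul_div_cancel₀ _ (hf k n).ne', add_sub_cancel, Real.log_exp]
      field_simp
    simp only [hrate, Finset.sum_const, Finset.card_univ, Fintype.card_fin, nsmul_eq_mul]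
    exact le_mul_of_one_le_left (hq k) hN'

lemma add_mem_achievablePowers {K N : ℕ} {a : ℝ} (ha : 0 < a)
    {f : Fin K → Fin N → ℝ} (hf : ∀ k n, 0 < f k n) {q₁ q₂ : Fin K → ℝ} {P₁ P₂ α β : ℝ}
    (h₁ : P₁ ∈ achievablePowers a f q₁) (h₂ : P₂ ∈ achievablePowers a f q₂)
    (hα : 0 ≤ α) (hβ : 0 ≤ β) (hαβ : α + β = 1) :
    α * P₁ + β * P₂ ∈ achievablePowers a f (fun k => α * q₁ k + β * q₂ k) := by
  obtain ⟨p₁, ρ₁, hp₁, hρ₁, hs₁, hr₁, rfl⟩ := h₁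
  obtain ⟨p₂, ρ₂, hp₂, hρ₂, hs₂, hr₂, rfl⟩ := h₂
  choose r hr hpow hlog using fun k n =>
    exists_perspective_log_ge (hf k n).le (mul_nonneg hα (hρ₁ k n).1)
      (mul_nonneg hβ (hρ₂ k n).1) (hp₁ k n) (hp₂ k n)
  refine ⟨r, fun k n => α * ρ₁ k n + β * ρ₂ k n, hr, fun k n => ⟨?_, ?_⟩, fun n => ?_,
    fun k => ?_, ?_⟩
  · exact add_nonneg (mul_nonneg hα (hρ₁ k n).1) (mul_nonneg hβ (hρ₂ k n).1)
  · nlinarith [(hρ₁ k n).2, (hρ₂ k n).2]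
  · rw [Finset.sum_add_distrib, ← Finset.mul_sum, ← Finset.mul_sum]
    nlinarith [hs₁ n, hs₂ n]
  · refine (add_le_add (mul_le_mul_of_nonneg_left (hr₁ k) hα)
      (mul_le_mul_of_nonneg_left (hr₂ k) hβ)).trans ?_
    rw [Finset.mul_sum, Finset.mul_sum, ← Finset.sum_add_distrib]
    refine Finset.sum_le_sum fun n _ => ?_
    have := mul_le_mul_of_nonneg_left (hlog k n) (one_div_pos.2 ha).le
    linarith
  · simp only [hpow, Finset.mul_sum, Finset.sum_add_distrib, mul_assoc]

/-- Minimal total power is convex in the demands. -/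
lemma sInf_achievablePowers_le {K N : ℕ} (hK : 0 < K) (hN : 0 < N) {a : ℝ} (ha : 0 < a)
    {f : Fin K → Fin N → ℝ} (hf : ∀ k n, 0 < f k n) {q₁ q₂ : Fin K → ℝ}
    (hq₁ : ∀ k, 0 ≤ q₁ k) (hq₂ : ∀ k, 0 ≤ q₂ k) {α β : ℝ}
    (hα : 0 ≤ α) (hβ : 0 ≤ β) (hαβ : α + β = 1) :
    sInf (achievablePowers a f (fun k => α * q₁ k + β * q₂ k)) ≤
      α * sInf (achievablePowers a f q₁) + β * sInf (achievablePowers a f q₂) := by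
  refine le_of_forall_pos_le_add fun ε hε => ?_
  obtain ⟨P₁, hP₁, hlt₁⟩ := exists_lt_of_csInf_lt (achievablePowers_nonempty hK hN ha hf hq₁)
    (lt_add_of_pos_right _ hε)
  obtain ⟨P₂, hP₂, hlt₂⟩ := exists_lt_of_csInf_lt (achievablePowers_nonempty hK hN ha hf hq₂)
    (lt_add_of_pos_right _ hε)
  have hmin := csInf_le (bddBelow_achievablePowers a f _)
    (add_mem_achievablePowers ha hf hP₁ hP₂ hα hβ hαβ)
  have h₁ := mul_le_mul_of_nonneg_left hlt₁.le hα
  have h₂ := mul_le_mul_of_nonneg_left hlt₂.le hβ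
  have hε' : α * ε + β * ε = ε := by rw [← add_mul, hαβ, one_mul]
  linarith

/-- T ↦ T·v(T) is convex on (0, ∞); consequently, for any
P_tc ≥ 0 the objective T ↦ T·v(T) + T·P_tc of problem (TEMin-2) is convex on
(0, ∞), i.e. (TEMin-2) is a convex optimization problem. -/
theorem temin2_convex
    (K N : ℕ) (hK : 0 < K) (hN : 0 < N)
    (a : ℝ) (ha : 0 < a)
    (f : Fin K → Fin N → ℝ) (hf : ∀ k n, 0 < f k n)
    (Q : Fin K → ℝ) (hQ : ∀ k, 0 < Q k)
    (v : ℝ → ℝ)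
    (hv : ∀ T : ℝ, 0 < T →
      v T = sInf {P : ℝ | ∃ p ρ : Fin K → Fin N → ℝ,
        (∀ k n, 0 ≤ p k n) ∧
        (∀ k n, 0 ≤ ρ k n ∧ ρ k n ≤ 1) ∧
        (∀ n, ∑ k, ρ k n ≤ 1) ∧
        (∀ k, Q k / T ≤ ∑ n, ρ k n * (1 / a * Real.log (1 + f k n * p k n))) ∧
        P = ∑ k, ∑ n, ρ k n * p k n}) :
    ConvexOn ℝ (Set.Ioi (0 : ℝ)) (fun T => T * v T) ∧
    ∀ Ptc : ℝ, 0 ≤ Ptc →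
      ConvexOn ℝ (Set.Ioi (0 : ℝ)) (fun T => T * v T + T * Ptc) := by
  have hv' : ∀ T : ℝ, 0 < T → v T = sInf (achievablePowers a f (fun k => Q k / T)) := hv
  have hconv : ConvexOn ℝ (Set.Ioi (0 : ℝ)) (fun T => T * v T) := by
    refine ⟨convex_Ioi 0, fun x hx y hy s t hs ht hst => ?_⟩
    have hT : s • x + t • y ∈ Set.Ioi (0 : ℝ) := convex_Ioi 0 hx hy hs ht hst
    simp only [smul_eq_mul, Set.mem_Ioi] at hx hy hT ⊢
    rw [hv' _ hT, hv' x hx, hv' y hy]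
    have hmin := sInf_achievablePowers_le hK hN ha hf
      (fun k => (div_pos (hQ k) hx).le) (fun k => (div_pos (hQ k) hy).le)
      (div_nonneg (mul_nonneg hs hx.le) hT.le) (div_nonneg (mul_nonneg ht hy.le) hT.le)
      (by rw [← add_div, div_self hT.ne'])
    have hdemand : (fun k => s * x / (s * x + t * y) * (Q k / x)
        + t * y / (s * x + t * y) * (Q k / y)) = fun k => Q k / (s * x + t * y) := by
      funext k
      have hT' := hT.ne'
      field_simp
      rw [hst, mul_one]
    rw [hdemand] at hmin
    refine (mul_le_mul_of_nonneg_left hmin hT.le).trans_eq ?_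
    have hT' := hT.ne'
    field_simp
  refine ⟨hconv, fun Ptc _ => hconv.add ⟨convex_Ioi 0, fun x _ y _ s t _ _ _ => ?_⟩⟩
  simp only [smul_eq_mul]
  exact le_of_eq (by ring)
end

section
/- Fix T > 0 and suppose λ* ∈ ℝ^K and β* ∈ ℝ^N with λ*_k ≥ 0 and β*_n ≥ 0 satisfy g_T(λ*, β*) = v(T) (strong duality holds at (λ*, β*)). Then −(1/T²)·Σ_k λ*_k·Q̄_k is a subgradient of v at T: for every T' > 0, v(T') ≥ v(T) − (1/T²)·(Σ_k λ*_k·Q̄_k)·(T' − T). -/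
/-- The partial Lagrangian term of one user on one subcarrier is bounded below, uniformly in the
rate `m` and the time share `ρ`. -/
lemma perspective_exp_sub_mul_ge {a f l m ρ : ℝ} (ha : 0 < a) (hf : 0 < f)
    (hm : 0 ≤ m) (hρ : 0 < ρ) (hρ1 : ρ ≤ 1) :
    -(l ^ 2 * f / (2 * a ^ 2)) ≤ ρ * (Real.exp (a * m / ρ) - 1) / f - l * m := by
  obtain ⟨x, hx, rfl⟩ : ∃ x, 0 ≤ x ∧ m = ρ * x := ⟨m / ρ, by positivity, by field_simp⟩
  have harg : a * (ρ * x) / ρ = a * x := by field_simp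
  have hexp := Real.quadratic_le_exp_of_nonneg (x := a * x) (by positivity)
  rw [harg]
  set C := l ^ 2 * f / (2 * a ^ 2) with hC
  have hC0 : 0 ≤ C := by positivity
  have hquad : -C ≤ (a * x + (a * x) ^ 2 / 2) / f - l * x := by
    have hsq : (a * x + (a * x) ^ 2 / 2) / f - l * x + C
        = a * x / f + (a * x - l * f / a) ^ 2 / (2 * f) := by
      rw [hC]; field_simp; ring
    have : 0 ≤ a * x / f + (a * x - l * f / a) ^ 2 / (2 * f) := by positivity
    linarith
  have hdiv : (a * x + (a * x) ^ 2 / 2) / f ≤ (Real.exp (a * x) - 1) / f := by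
    gcongr; linarith
  calc -C ≤ ρ * -C := by nlinarith
    _ ≤ ρ * ((Real.exp (a * x) - 1) / f - l * x) := by gcongr; linarith
    _ = ρ * (Real.exp (a * x) - 1) / f - l * (ρ * x) := by ring

/-- The Lagrangian of the reformulated problem is bounded below on its domain. -/
lemma bddBelow_lagrangian {K N : ℕ} {a T : ℝ} (ha : 0 < a)
    {f : Fin K → Fin N → ℝ} (hf : ∀ k n, 0 < f k n) (Q : Fin K → ℝ)
    (lam : Fin K → ℝ) {β : Fin N → ℝ} (hβ : ∀ n, 0 ≤ β n) :
    BddBelow {y : ℝ | ∃ m ρ : Fin K → Fin N → ℝ,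
        (∀ k n, 0 ≤ m k n) ∧
        (∀ k n, 0 ≤ ρ k n ∧ ρ k n ≤ 1) ∧
        (∀ k n, ρ k n = 0 → m k n = 0) ∧
        y = (∑ k, ∑ n,
              if ρ k n = 0 then 0
              else ρ k n * (Real.exp (a * m k n / ρ k n) - 1) / f k n)
            - (∑ k, lam k * ((∑ n, m k n) - Q k / T))
            + (∑ n, β n * ((∑ k, ρ k n) - 1))} := by
  refine ⟨(∑ k, ∑ n, -(lam k ^ 2 * f k n / (2 * a ^ 2))) + (∑ k, lam k * (Q k / T))
    + ∑ n, β n * (-1), ?_⟩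
  rintro y ⟨m, ρ, hm, hρ, hzero, rfl⟩
  have hterm : ∑ k, ∑ n, -(lam k ^ 2 * f k n / (2 * a ^ 2)) ≤
      ∑ k, ∑ n, ((if ρ k n = 0 then 0
        else ρ k n * (Real.exp (a * m k n / ρ k n) - 1) / f k n) - lam k * m k n) := by
    refine Finset.sum_le_sum fun k _ => Finset.sum_le_sum fun n _ => ?_
    have hfk := hf k n
    split_ifs with h
    · rw [hzero k n h]
      have : 0 ≤ lam k ^ 2 * f k n / (2 * a ^ 2) := by positivity
      linarith
    · exact perspective_exp_sub_mul_ge ha hfk (hm k n)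
        (lt_of_le_of_ne (hρ k n).1 (Ne.symm h)) (hρ k n).2
  have hshare : ∑ n, β n * (-1) ≤ ∑ n, β n * ((∑ k, ρ k n) - 1) := by
    refine Finset.sum_le_sum fun n _ => mul_le_mul_of_nonneg_left ?_ (hβ n)
    have : 0 ≤ ∑ k, ρ k n := Finset.sum_nonneg fun k _ => (hρ k n).1
    linarith
  simp only [Finset.sum_sub_distrib, ← Finset.mul_sum] at hterm
  have hrate : ∑ k, lam k * ((∑ n, m k n) - Q k / T)
      = ∑ k, lam k * ∑ n, m k n - ∑ k, lam k * (Q k / T) := by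
    simp only [mul_sub, Finset.sum_sub_distrib]
  linarith

/-- The power minimization problem is feasible for any rate targets: share every subcarrier
equally and transmit with enough power. -/
lemma exists_feasible_allocation {K N : ℕ} (hK : 0 < K) (hN : 0 < N) {a : ℝ} (ha : 0 < a)
    {f : Fin K → Fin N → ℝ} (hf : ∀ k n, 0 < f k n) {R : Fin K → ℝ} (hR : ∀ k, 0 ≤ R k) :
    ∃ p ρ : Fin K → Fin N → ℝ,
      (∀ k n, 0 ≤ p k n) ∧
      (∀ k n, 0 ≤ ρ k n ∧ ρ k n ≤ 1) ∧
      (∀ n, ∑ k, ρ k n ≤ 1) ∧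
      (∀ k, R k ≤ ∑ n, ρ k n * (1 / a * Real.log (1 + f k n * p k n))) := by
  have hK' : (0 : ℝ) < K := by exact_mod_cast hK
  have hK1 : (1 : ℝ) ≤ K := by exact_mod_cast hK
  have hN1 : (1 : ℝ) ≤ N := by exact_mod_cast hN
  refine ⟨fun k n => (Real.exp (a * (K * R k)) - 1) / f k n, fun _ _ => 1 / K, ?_, ?_, ?_, ?_⟩
  · intro k n
    have hRk := hR k
    exact div_nonneg (sub_nonneg.2 (Real.one_le_exp (by positivity))) (hf k n).le
  · exact fun _ _ => ⟨by positivity, (div_le_one hK').2 hK1⟩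
  · intro n
    simp [hK'.ne']
  · intro k
    have hrate : ∀ n, (1 / K : ℝ) * (1 / a * Real.log (1 + f k n *
        ((Real.exp (a * (K * R k)) - 1) / f k n))) = R k := by
      intro n
      rw [mul_div_cancel₀ _ (hf k n).ne', add_sub_cancel, Real.log_exp]
      field_simp
    simp only [hrate, Finset.sum_const, Finset.card_univ, Fintype.card_fin, nsmul_eq_mul]
    nlinarith [hR k]

/-- Tangent-line bound for the convex function `T ↦ 1 / T`. -/
lemma one_div_sub_one_div_le {T T' : ℝ} (hT : 0 < T) (hT' : 0 < T') :
    1 / T - 1 / T' ≤ 1 / T ^ 2 * (T' - T) := by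
  have h : 1 / T ^ 2 * (T' - T) - (1 / T - 1 / T') = (T' - T) ^ 2 / (T ^ 2 * T') := by
    field_simp
  have : 0 ≤ (T' - T) ^ 2 / (T ^ 2 * T') := by positivity
  linarith

/-- If at T > 0 dual variables λ* ≥ 0, β* ≥ 0 satisfy strong
duality g_T(λ*, β*) = v(T), then −(1/T²)·Σ_k λ*_k·Q̄_k is a subgradient of v at
T: v(T') ≥ v(T) − (1/T²)·(Σ_k λ*_k·Q̄_k)·(T' − T) for every T' > 0. -/
theorem v_subgradient
    (K N : ℕ) (hK : 0 < K) (hN : 0 < N)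
    (a : ℝ) (ha : 0 < a)
    (f : Fin K → Fin N → ℝ) (hf : ∀ k n, 0 < f k n)
    (Q : Fin K → ℝ) (hQ : ∀ k, 0 < Q k)
    (v : ℝ → ℝ)
    (hv : ∀ T : ℝ, 0 < T →
      v T = sInf {P : ℝ | ∃ p ρ : Fin K → Fin N → ℝ,
        (∀ k n, 0 ≤ p k n) ∧
        (∀ k n, 0 ≤ ρ k n ∧ ρ k n ≤ 1) ∧
        (∀ n, ∑ k, ρ k n ≤ 1) ∧
        (∀ k, Q k / T ≤ ∑ n, ρ k n * (1 / a * Real.log (1 + f k n * p k n))) ∧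
        P = ∑ k, ∑ n, ρ k n * p k n})
    (T : ℝ) (hT : 0 < T)
    (lam : Fin K → ℝ) (β : Fin N → ℝ)
    (hlam : ∀ k, 0 ≤ lam k) (hβ : ∀ n, 0 ≤ β n)
    (hstrong :
      sInf {y : ℝ | ∃ m ρ : Fin K → Fin N → ℝ,
        (∀ k n, 0 ≤ m k n) ∧
        (∀ k n, 0 ≤ ρ k n ∧ ρ k n ≤ 1) ∧
        (∀ k n, ρ k n = 0 → m k n = 0) ∧
        y = (∑ k, ∑ n,
              if ρ k n = 0 then 0
              else ρ k n * (Real.exp (a * m k n / ρ k n) - 1) / f k n)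
            - (∑ k, lam k * ((∑ n, m k n) - Q k / T))
            + (∑ n, β n * ((∑ k, ρ k n) - 1))}
      = v T) :
    ∀ T' : ℝ, 0 < T' →
      v T' ≥ v T - 1 / T ^ 2 * (∑ k, lam k * Q k) * (T' - T) := by
  intro T' hT'
  rw [ge_iff_le, hv T' hT']
  apply le_csInf
  · obtain ⟨p, ρ, hp, hρ, hsum, hrate⟩ :=
      exists_feasible_allocation hK hN ha hf (fun k => (div_pos (hQ k) hT').le)
    exact ⟨_, p, ρ, hp, hρ, hsum, hrate, rfl⟩
  rintro P ⟨p, ρ, hp, hρ, hsum, hrate, rfl⟩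
  have hlog : ∀ k n, 0 ≤ f k n * p k n := fun k n => mul_nonneg (hf k n).le (hp k n)
  have hr : ∀ k n, 0 ≤ 1 / a * Real.log (1 + f k n * p k n) := fun k n =>
    mul_nonneg (by positivity) (Real.log_nonneg (by linarith [hlog k n]))
  have hdual := csInf_le (bddBelow_lagrangian (T := T) ha hf Q lam hβ)
    ⟨fun k n => ρ k n * (1 / a * Real.log (1 + f k n * p k n)), ρ,
      fun k n => mul_nonneg (hρ k n).1 (hr k n), hρ, fun k n h => by simp [h], rfl⟩
  rw [hstrong] at hdual
  have hpower : ∀ k n, (if ρ k n = 0 then 0 else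
      ρ k n * (Real.exp (a * (ρ k n * (1 / a * Real.log (1 + f k n * p k n))) / ρ k n) - 1)
        / f k n) = ρ k n * p k n := by
    intro k n
    split_ifs with h
    · simp [h]
    · have harg : a * (ρ k n * (1 / a * Real.log (1 + f k n * p k n))) / ρ k n
          = Real.log (1 + f k n * p k n) := by field_simp
      rw [harg, Real.exp_log (by linarith [hlog k n])]
      have := (hf k n).ne'
      field_simp
      ring
  simp only [hpower] at hdual
  have hshare : ∑ n, β n * ((∑ k, ρ k n) - 1) ≤ 0 :=
    Finset.sum_nonpos fun n _ =>
      mul_nonpos_of_nonneg_of_nonpos (hβ n) (sub_nonpos.2 (hsum n))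
  have hslack : (∑ k, lam k * Q k) * (1 / T' - 1 / T) ≤
      ∑ k, lam k * ((∑ n, ρ k n * (1 / a * Real.log (1 + f k n * p k n))) - Q k / T) := by
    rw [Finset.sum_mul]
    refine Finset.sum_le_sum fun k _ => ?_
    calc lam k * Q k * (1 / T' - 1 / T) = lam k * (Q k / T' - Q k / T) := by ring
      _ ≤ _ := mul_le_mul_of_nonneg_left (sub_le_sub_right (hrate k) _) (hlam k)
  have hS : 0 ≤ ∑ k, lam k * Q k :=
    Finset.sum_nonneg fun k _ => mul_nonneg (hlam k) (hQ k).le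
  have htangent := mul_le_mul_of_nonneg_left (one_div_sub_one_div_le hT hT') hS
  linarith
end

section
/- Fix a > 0, f > 0 and q ≥ 0. The energy function t ↦ t·(exp(a·q/t) − 1)/f is nonincreasing on (0, ∞), and if q > 0 it is strictly decreasing on (0, ∞): delivering a fixed amount of data q consumes strictly less energy when the transmission time is longer. -/
/-- For `c > 0`, the function `t ↦ t * (exp (c / t) - 1)` is strictly decreasing on `(0, ∞)`,
since the secant slopes of `exp` at `0` are strictly increasing. -/
theorem strictAntiOn_mul_exp_div_sub_one {c : ℝ} (hc : 0 < c) :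
    StrictAntiOn (fun t : ℝ => t * (Real.exp (c / t) - 1)) (Set.Ioi 0) := by
  intro s hs t ht hst
  rw [Set.mem_Ioi] at hs ht
  have hslope := strictConvexOn_exp.secant_strict_mono (Set.mem_univ 0) (Set.mem_univ (c / t))
    (Set.mem_univ (c / s)) (div_pos hc ht).ne' (div_pos hc hs).ne'
    (div_lt_div_of_pos_left hc hs hst)
  have slope_eq (u : ℝ) :
      (Real.exp (c / u) - Real.exp 0) / (c / u - 0) = u * (Real.exp (c / u) - 1) / c := by
    rw [Real.exp_zero, sub_zero, div_div_eq_mul_div, mul_comm]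
  rw [slope_eq, slope_eq] at hslope
  exact (div_lt_div_iff_of_pos_right hc).mp hslope

/-- For a > 0, f > 0 and q ≥ 0, the energy function
t ↦ t·(exp(a·q/t) − 1)/f is nonincreasing on (0, ∞), and strictly decreasing on
(0, ∞) when q > 0. -/
theorem energy_decreasing_in_time (a f q : ℝ) (ha : 0 < a) (hf : 0 < f)
    (hq : 0 ≤ q) :
    AntitoneOn (fun t : ℝ => t * (Real.exp (a * q / t) - 1) / f) (Set.Ioi 0) ∧
    (0 < q →
      StrictAntiOn (fun t : ℝ => t * (Real.exp (a * q / t) - 1) / f)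
        (Set.Ioi 0)) := by
  have strict (hq' : 0 < q) :
      StrictAntiOn (fun t : ℝ => t * (Real.exp (a * q / t) - 1) / f) (Set.Ioi 0) :=
    fun _ hs _ ht hst => div_lt_div_of_pos_right
      (strictAntiOn_mul_exp_div_sub_one (mul_pos ha hq') hs ht hst) hf
  refine ⟨?_, strict⟩
  rcases hq.eq_or_lt with rfl | hq'
  · simp [AntitoneOn]
  · exact (strict hq').antitoneOn
end

section
/- Suppose (λ*, β*) with λ*_k ≥ 0 and β* ≥ 0 attains the supremum of the dual function g of problem (P1) and satisfies g(λ*, β*) = V (strong duality). Then λ*_k > 0 for every k, β* > 0, β* < (min_k α_k)·P_rc/P_avg, and for every k the stationarity equation α_k·P_rc − β*·P_avg + Σ_n u_{k,n}(β*, λ*_k) = 0 holds, where u_{k,n}(β, λ) := max(λ/a − β/f_{k,n}, 0) − (λ/a)·max(ln(λ·f_{k,n}/(a·β)), 0). -/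
open Real Finset

/-- The Lagrangian of a single terminal per unit of its time, at rate vector `r`; `A` is the energy
price of the terminal, `P` the average power limit. -/
noncomputable def unitLagrangian {N : ℕ} (a A P : ℝ) (f : Fin N → ℝ) (β lam : ℝ)
    (r : Fin N → ℝ) : ℝ :=
  A - β * P + ∑ n, (β * (exp (a * r n) - 1) / f n - lam * r n)

/-- The minimal value over `r ≥ 0` of `β * (exp (a * r) - 1) / φ - lam * r`. -/
noncomputable def rateMin (a β lam φ : ℝ) : ℝ :=
  max (lam / a - β / φ) 0 - lam / a * max (log (lam * φ / (a * β))) 0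

theorem rateMin_le {a β lam φ : ℝ} (ha : 0 < a) (hβ : 0 < β) (hlam : 0 ≤ lam) (hφ : 0 < φ)
    {r : ℝ} (hr : 0 ≤ r) : rateMin a β lam φ ≤ β * (exp (a * r) - 1) / φ - lam * r := by
  obtain ⟨x, hx⟩ : ∃ x, x = lam * φ / (a * β) := ⟨_, rfl⟩
  have hlamx : lam = x * (a * β) / φ := by rw [hx]; field_simp
  have hx0 : 0 ≤ x := by rw [hx]; positivity
  have key : max (x - 1) 0 - x * max (log x) 0 ≤ exp (a * r) - 1 - x * (a * r) := by
    have har : 0 ≤ a * r := by positivity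
    rcases le_total x 1 with h1 | h1
    · rw [max_eq_right (by linarith), max_eq_right (log_nonpos hx0 h1)]
      nlinarith [add_one_le_exp (a * r)]
    · rw [max_eq_left (by linarith), max_eq_left (log_nonneg h1)]
      have h2 := add_one_le_exp (a * r - log x)
      rw [exp_sub, exp_log (by linarith), le_div_iff₀ (by linarith)] at h2
      nlinarith
  have e1 : lam / a - β / φ = β / φ * (x - 1) := by rw [hlamx]; field_simp
  have e2 : lam / a = β / φ * x := by rw [hlamx]; field_simp
  have hc : 0 ≤ β / φ := by positivity
  unfold rateMin
  rw [← hx, e1, show max (β / φ * (x - 1)) 0 = β / φ * max (x - 1) 0 by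
    rw [mul_max_of_nonneg _ _ hc, mul_zero], e2]
  have := mul_le_mul_of_nonneg_left key hc
  calc _ = β / φ * (max (x - 1) 0 - x * max (log x) 0) := by ring
    _ ≤ _ := this
    _ = _ := by rw [hlamx]; field_simp

theorem exists_rateMin_eq {a β lam φ : ℝ} (ha : 0 < a) (hβ : 0 < β) (hlam : 0 ≤ lam)
    (hφ : 0 < φ) : ∃ r, 0 ≤ r ∧ β * (exp (a * r) - 1) / φ - lam * r = rateMin a β lam φ := by
  unfold rateMin
  have hx0 : 0 ≤ lam * φ / (a * β) := by positivity
  rcases le_total (lam * φ / (a * β)) 1 with h1 | h1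
  · refine ⟨0, le_rfl, ?_⟩
    have : lam / a - β / φ ≤ 0 := by
      rw [div_le_one (by positivity)] at h1
      rw [sub_nonpos, div_le_div_iff₀ ha hφ]; linarith
    rw [max_eq_right this, max_eq_right (log_nonpos hx0 h1)]
    simp
  · have hl := log_nonneg h1
    refine ⟨log (lam * φ / (a * β)) / a, by positivity, ?_⟩
    have : 0 ≤ lam / a - β / φ := by
      rw [one_le_div (by positivity)] at h1
      rw [sub_nonneg, div_le_div_iff₀ hφ ha]; linarith
    rw [max_eq_left this, max_eq_left hl, mul_div_cancel₀ _ ha.ne', exp_log (by linarith)]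
    field_simp

theorem continuousWithinAt_rateMin {a β φ : ℝ} (ha : 0 < a) (hβ : 0 < β) (hφ : 0 < φ)
    {lam : ℝ} (hlam : 0 ≤ lam) :
    ContinuousWithinAt (fun l => rateMin a β l φ) (Set.Ici 0) lam := by
  have hc : Continuous fun l : ℝ =>
      max (l / a - β / φ) 0 - l / a * log (max (l * φ / (a * β)) 1) := by
    have : Continuous fun l : ℝ => log (max (l * φ / (a * β)) 1) :=
      Continuous.log (by fun_prop) fun l => by
        have := le_max_right (l * φ / (a * β)) 1
        linarith
    fun_prop
  have hlog : ∀ x : ℝ, 0 ≤ x → max (log x) 0 = log (max x 1) := by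
    intro x hx
    rcases le_total x 1 with h1 | h1
    · rw [max_eq_right h1, log_one, max_eq_right (log_nonpos hx h1)]
    · rw [max_eq_left h1, max_eq_left (log_nonneg h1)]
  have heq : ∀ l ∈ Set.Ici (0 : ℝ), rateMin a β l φ =
      max (l / a - β / φ) 0 - l / a * log (max (l * φ / (a * β)) 1) := by
    intro l hl
    have hl0 : 0 ≤ l := hl
    rw [rateMin, hlog _ (by positivity)]
  exact hc.continuousWithinAt.congr heq (heq lam hlam)

section Dual

variable {K N : ℕ} {a P : ℝ} {A : Fin K → ℝ} {f : Fin K → Fin N → ℝ} {Q : Fin K → ℝ}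

/-- The set of values of the Lagrangian. -/
def lagrangianValues (a P : ℝ) (A : Fin K → ℝ) (f : Fin K → Fin N → ℝ) (Q : Fin K → ℝ)
    (lam : Fin K → ℝ) (β : ℝ) : Set ℝ :=
  {y : ℝ | ∃ (s : Fin K → Fin N → ℝ) (t : Fin K → ℝ),
    (∀ k n, 0 ≤ s k n) ∧ (∀ k, 0 < t k) ∧
    y = (∑ k, A k * t k) - (∑ k, lam k * ((∑ n, s k n) - Q k))
      + β * ((∑ k, ∑ n, t k * (exp (a * s k n / t k) - 1) / f k n) - P * ∑ k, t k)}

/-- The set of objective values of the primal problem. -/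
def primalValues (a P : ℝ) (A : Fin K → ℝ) (f : Fin K → Fin N → ℝ) (Q : Fin K → ℝ) : Set ℝ :=
  {E : ℝ | ∃ (s : Fin K → Fin N → ℝ) (t : Fin K → ℝ),
    (∀ k n, 0 ≤ s k n) ∧ (∀ k, 0 < t k) ∧ (∀ k, Q k ≤ ∑ n, s k n) ∧
    (∑ k, ∑ n, t k * (exp (a * s k n / t k) - 1) / f k n ≤ P * ∑ k, t k) ∧
    E = ∑ k, A k * t k}

/-- Writing `s k n = t k * r k n` makes the Lagrangian linear in `t`. -/
theorem mem_lagrangianValues_iff {lam : Fin K → ℝ} {β y : ℝ} :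
    y ∈ lagrangianValues a P A f Q lam β ↔
      ∃ (r : Fin K → Fin N → ℝ) (t : Fin K → ℝ), (∀ k n, 0 ≤ r k n) ∧ (∀ k, 0 < t k) ∧
        y = ∑ k, t k * unitLagrangian a (A k) P (f k) β (lam k) (r k) + ∑ k, lam k * Q k := by
  have key : ∀ (r : Fin K → Fin N → ℝ) (t : Fin K → ℝ), (∀ k, 0 < t k) →
      (∑ k, A k * t k) - (∑ k, lam k * ((∑ n, t k * r k n) - Q k))
        + β * ((∑ k, ∑ n, t k * (exp (a * (t k * r k n) / t k) - 1) / f k n) - P * ∑ k, t k)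
      = ∑ k, t k * unitLagrangian a (A k) P (f k) β (lam k) (r k) + ∑ k, lam k * Q k := by
    intro r t ht
    rw [mul_sub, mul_sum, mul_sum, mul_sum, ← sum_sub_distrib, ← sum_sub_distrib,
      ← sum_add_distrib, ← sum_add_distrib]
    refine sum_congr rfl fun k _ => ?_
    have e : ∀ n, a * (t k * r k n) / t k = a * r k n := fun n => by
      field_simp [(ht k).ne']
    simp only [e, unitLagrangian, sum_sub_distrib, mul_add, mul_sub, mul_sum]
    have e2 : ∀ n, t k * (β * (exp (a * r k n) - 1) / f k n)
        = β * (t k * (exp (a * r k n) - 1) / f k n) := fun n => by ring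
    have e3 : ∀ n, t k * (lam k * r k n) = lam k * (t k * r k n) := fun n => by ring
    simp only [← mul_sub, mul_one, e2, e3] at *
    ring_nf
  constructor
  · rintro ⟨s, t, hs, ht, rfl⟩
    refine ⟨fun k n => s k n / t k, t, fun k n => div_nonneg (hs k n) (ht k).le, ht, ?_⟩
    rw [← key _ t ht]
    have e : ∀ k n, t k * (s k n / t k) = s k n := fun k n => mul_div_cancel₀ _ (ht k).ne'
    simp only [e]
  · rintro ⟨r, t, hr, ht, rfl⟩
    exact ⟨fun k n => t k * r k n, t, fun k n => mul_nonneg (ht k).le (hr k n), ht,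
      (key r t ht).symm⟩

theorem sInf_lagrangianValues {lam : Fin K → ℝ} {β : ℝ}
    (h : ∀ k, ∀ r : Fin N → ℝ, (∀ n, 0 ≤ r n) →
      0 ≤ unitLagrangian a (A k) P (f k) β (lam k) r) :
    sInf (lagrangianValues a P A f Q lam β) = ∑ k, lam k * Q k := by
  obtain ⟨C, hC⟩ : ∃ C, C = ∑ k, unitLagrangian a (A k) P (f k) β (lam k) 0 := ⟨_, rfl⟩
  have hC0 : 0 ≤ C := hC ▸ sum_nonneg fun k _ => h k 0 fun _ => le_rfl
  have hmem : ∀ τ : ℝ, 0 < τ →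
      τ * C + ∑ k, lam k * Q k ∈ lagrangianValues a P A f Q lam β := fun τ hτ =>
    mem_lagrangianValues_iff.2
      ⟨0, fun _ => τ, fun _ _ => le_rfl, fun _ => hτ, by rw [hC, mul_sum]; rfl⟩
  refine csInf_eq_of_forall_ge_of_forall_gt_exists_lt ⟨_, hmem 1 one_pos⟩ ?_ ?_
  · rintro y hy
    obtain ⟨r, t, hr, ht, rfl⟩ := mem_lagrangianValues_iff.1 hy
    have := sum_nonneg fun k (_ : k ∈ univ) => mul_nonneg (ht k).le (h k (r k) (hr k))
    linarith
  · intro w hw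
    have hd : 0 < w - ∑ k, lam k * Q k := sub_pos.2 hw
    refine ⟨_, hmem ((w - ∑ k, lam k * Q k) / (C + 1)) (by positivity), ?_⟩
    have : (w - ∑ k, lam k * Q k) / (C + 1) * C < w - ∑ k, lam k * Q k := by
      rw [div_mul_eq_mul_div, div_lt_iff₀ (by positivity)]
      nlinarith
    linarith

theorem unitLagrangian_nonneg_of_bddBelow {lam : Fin K → ℝ} {β : ℝ}
    (h : BddBelow (lagrangianValues a P A f Q lam β)) (k : Fin K) {r : Fin N → ℝ}
    (hr : ∀ n, 0 ≤ r n) : 0 ≤ unitLagrangian a (A k) P (f k) β (lam k) r := by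
  by_contra! hneg
  obtain ⟨b, hb⟩ := h
  obtain ⟨v, hv⟩ : ∃ v, v = unitLagrangian a (A k) P (f k) β (lam k) r := ⟨_, rfl⟩
  rw [← hv] at hneg
  obtain ⟨C, hC⟩ : ∃ C, C = ∑ j, unitLagrangian a (A j) P (f j) β (lam j) r
    + ∑ j, lam j * Q j := ⟨_, rfl⟩
  have hmem : ∀ τ : ℝ, 0 ≤ τ → b ≤ τ * v + C := fun τ hτ =>
    hb (mem_lagrangianValues_iff.2 ⟨fun _ => r, fun j => 1 + if j = k then τ else 0,
      fun _ => hr, fun j => by dsimp only; split_ifs <;> linarith, by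
        simp only [add_mul, one_mul, sum_add_distrib, ite_mul, zero_mul, sum_ite_eq',
          mem_univ, if_true, hC, hv]
        ring⟩)
  have h1 := hmem ((|b - C| + 1) / -v) (div_nonneg (by positivity) (by linarith))
  have h2 : (|b - C| + 1) / -v * v = -(|b - C| + 1) := by
    field_simp [hneg.ne]
  linarith [neg_abs_le (b - C)]

theorem primalValues_nonempty (hK : 0 < K) (hN : 0 < N) (ha : 0 < a) (hP : 0 < P)
    (hf : ∀ k n, 0 < f k n) (hQ : ∀ k, 0 < Q k) : (primalValues a P A f Q).Nonempty := by
  obtain ⟨B, hB⟩ : ∃ B, B = ∑ k, ∑ n, 2 * (a * Q k) / f k n := ⟨_, rfl⟩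
  have hB0 : 0 ≤ B := hB ▸ sum_nonneg fun k _ => sum_nonneg fun n _ => by
    have := hQ k; have := hf k n; positivity
  have hS : 0 ≤ ∑ k, a * Q k := sum_nonneg fun k _ => by have := hQ k; positivity
  obtain ⟨τ, hτ⟩ : ∃ τ, τ = 1 + B / P + ∑ k, a * Q k := ⟨_, rfl⟩
  have hBP : 0 ≤ B / P := by positivity
  have hτ0 : 0 < τ := by linarith
  refine ⟨_, fun k _ => Q k, fun _ => τ, fun k _ => (hQ k).le, fun _ => hτ0, fun k => ?_, ?_, rfl⟩
  · have : (1 : ℝ) ≤ N := by exact_mod_cast hN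
    simp only [sum_const, card_univ, Fintype.card_fin, nsmul_eq_mul]
    nlinarith [hQ k]
  · calc _ ≤ B := by
          rw [hB]
          refine sum_le_sum fun k _ => sum_le_sum fun n _ => ?_
          refine div_le_div_of_nonneg_right ?_ (hf k n).le
          have hq : a * Q k ≤ τ := by
            have := single_le_sum (f := fun k => a * Q k)
              (fun j _ => (mul_pos ha (hQ j)).le) (mem_univ k)
            linarith
          have hx0 : 0 ≤ a * Q k / τ := by have := hQ k; positivity
          have hx1 : a * Q k / τ ≤ 1 := (div_le_one hτ0).2 hq
          have h3 := Real.abs_exp_sub_one_le (x := a * Q k / τ) (by rwa [abs_of_nonneg hx0])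
          rw [abs_of_nonneg hx0] at h3
          have h4 := mul_le_mul_of_nonneg_left ((le_abs_self _).trans h3) hτ0.le
          calc _ ≤ _ := h4
            _ = _ := by field_simp
      _ ≤ P * τ := by
          have : B = P * (B / P) := by field_simp
          nlinarith
      _ ≤ _ := by
          refine mul_le_mul_of_nonneg_left ?_ hP.le
          have : (1 : ℝ) ≤ K := by exact_mod_cast hK
          simp only [sum_const, card_univ, Fintype.card_fin, nsmul_eq_mul]
          nlinarith

theorem sInf_primalValues_pos (hK : 0 < K) (hN : 0 < N) (ha : 0 < a) (hP : 0 < P)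
    (hf : ∀ k n, 0 < f k n) (hQ : ∀ k, 0 < Q k) (hA : ∀ k, 0 < A k) :
    0 < sInf (primalValues a P A f Q) := by
  have : Nonempty (Fin K) := ⟨⟨0, hK⟩⟩
  have : Nonempty (Fin N) := ⟨⟨0, hN⟩⟩
  let k : Fin K := ⟨0, hK⟩
  obtain ⟨m, hm⟩ := Finite.exists_min A
  obtain ⟨p, hp⟩ := Finite.exists_max (f k)
  have hN' : (0 : ℝ) < N := by exact_mod_cast hN
  have hQk := hQ k
  have hfp := hf k p
  have hAm := hA m
  obtain ⟨c, hc⟩ : ∃ c, c = (a * (Q k / N)) ^ 2 / (2 * f k p * P) := ⟨_, rfl⟩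
  have hc0 : 0 < c := by rw [hc]; positivity
  refine lt_of_lt_of_le (mul_pos hAm (sqrt_pos.2 hc0))
    (le_csInf (primalValues_nonempty hK hN ha hP hf hQ) ?_)
  rintro _ ⟨s, t, hs, ht, hQs, hpow, rfl⟩
  obtain ⟨n, hn⟩ : ∃ n, Q k / N ≤ s k n := by
    by_contra! hlt
    have := sum_lt_sum_of_nonempty univ_nonempty fun n (_ : n ∈ univ) => hlt n
    simp only [sum_const, card_univ, Fintype.card_fin, nsmul_eq_mul] at this
    rw [mul_div_cancel₀ _ hN'.ne'] at this
    linarith [hQs k]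
  have hterm0 : ∀ j i, 0 ≤ t j * (exp (a * s j i / t j) - 1) / f j i := fun j i => by
    have h1 : 0 ≤ a * s j i / t j := div_nonneg (mul_nonneg ha.le (hs j i)) (ht j).le
    have h2 := add_one_le_exp (a * s j i / t j)
    exact div_nonneg (mul_nonneg (ht j).le (by linarith)) (hf j i).le
  have hterm : t k * (exp (a * s k n / t k) - 1) / f k n ≤ P * ∑ j, t j :=
    ((single_le_sum (f := fun i => t k * (exp (a * s k i / t k) - 1) / f k i)
      (fun i _ => hterm0 k i) (mem_univ n)).trans
      (single_le_sum (f := fun j => ∑ i, t j * (exp (a * s j i / t j) - 1) / f j i)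
        (fun j _ => sum_nonneg fun i _ => hterm0 j i) (mem_univ k))).trans hpow
  have htk := ht k
  have hT : t k ≤ ∑ j, t j := single_le_sum (fun j _ => (ht j).le) (mem_univ k)
  have hx0 : 0 ≤ a * s k n / t k := div_nonneg (mul_nonneg ha.le (hs k n)) htk.le
  have hquad := quadratic_le_exp_of_nonneg hx0
  have hfn := hf k n
  have h1 : (a * s k n) ^ 2 / 2 ≤ f k n * (P * ∑ j, t j) * t k := by
    rw [div_le_iff₀ hfn] at hterm
    have h2 : t k * ((a * s k n / t k) ^ 2 / 2) ≤ (P * ∑ j, t j) * f k n :=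
      (mul_le_mul_of_nonneg_left (by linarith) htk.le).trans hterm
    have h3 : (a * s k n) ^ 2 / 2 = t k * ((a * s k n / t k) ^ 2 / 2) * t k := by field_simp
    rw [h3]
    nlinarith
  have hTpos : 0 < ∑ j, t j := htk.trans_le hT
  have hcT : c ≤ (∑ j, t j) ^ 2 := by
    rw [hc, div_le_iff₀ (by positivity)]
    have h4 : (a * (Q k / N)) ^ 2 ≤ (a * s k n) ^ 2 := by gcongr
    have h5 : f k n * (P * ∑ j, t j) * t k ≤ f k p * (P * ∑ j, t j) * ∑ j, t j := by
      gcongr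
      exact hp n
    nlinarith
  calc A m * √c ≤ A m * ∑ j, t j := by
        gcongr
        exact sqrt_le_iff.2 ⟨hTpos.le, hcT⟩
    _ = ∑ j, A m * t j := mul_sum _ _ _
    _ ≤ _ := sum_le_sum fun j _ => mul_le_mul_of_nonneg_right (hm j) (ht j).le

theorem continuousWithinAt_sum_rateMin {β lam : ℝ} {φ : Fin N → ℝ} (ha : 0 < a) (hβ : 0 < β)
    (hφ : ∀ n, 0 < φ n) (hlam : 0 ≤ lam) :
    ContinuousWithinAt (fun l => ∑ n, rateMin a β l (φ n)) (Set.Ici 0) lam :=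
  tendsto_finsetSum _ fun n _ => continuousWithinAt_rateMin ha hβ (hφ n) hlam

/-- Scaling the multipliers by `c ≤ 1` keeps them dual feasible, so a simultaneous increase of one
rate multiplier by `δ` cannot pay off at a dual optimum. -/
theorem scale_add_le_of_isMax {lam : Fin K → ℝ} {β : ℝ} (hA : ∀ k, 0 < A k)
    (hlam : ∀ k, 0 ≤ lam k) (hβ : 0 ≤ β)
    (hnonneg : ∀ k, ∀ r : Fin N → ℝ, (∀ n, 0 ≤ r n) →
      0 ≤ unitLagrangian a (A k) P (f k) β (lam k) r)
    (hmax : ∀ (lam' : Fin K → ℝ) (β' : ℝ), (∀ k, 0 ≤ lam' k) → 0 ≤ β' →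
      sInf (lagrangianValues a P A f Q lam' β') ≤ sInf (lagrangianValues a P A f Q lam β))
    (k : Fin K) {c δ : ℝ} (hc0 : 0 ≤ c) (hc1 : c ≤ 1) (hδ : 0 ≤ δ)
    (hk : ∀ r : Fin N → ℝ, (∀ n, 0 ≤ r n) →
      0 ≤ unitLagrangian a (A k) P (f k) (c * β) (c * lam k + δ) r) :
    c * ∑ j, lam j * Q j + δ * Q k ≤ ∑ j, lam j * Q j := by
  have h := hmax (fun j => c * lam j + if j = k then δ else 0) (c * β)
    (fun j => add_nonneg (mul_nonneg hc0 (hlam j)) (by split_ifs <;> simp [hδ]))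
    (mul_nonneg hc0 hβ)
  rw [sInf_lagrangianValues hnonneg, sInf_lagrangianValues] at h
  · simpa [add_mul, sum_add_distrib, mul_sum, mul_assoc] using h
  · intro j r hr
    by_cases hj : j = k
    · subst hj
      simpa using hk r hr
    · simp only [hj, if_false, add_zero]
      have e : unitLagrangian a (A j) P (f j) (c * β) (c * lam j) r
          = (1 - c) * A j + c * unitLagrangian a (A j) P (f j) β (lam j) r := by
        simp only [unitLagrangian, mul_add, mul_sum]
        have : ∀ n, c * β * (exp (a * r n) - 1) / f j n - c * lam j * r n
            = c * (β * (exp (a * r n) - 1) / f j n - lam j * r n) := fun n => by ring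
        simp only [this]
        ring
      rw [e]
      exact add_nonneg (mul_nonneg (by linarith) (hA j).le) (mul_nonneg hc0 (hnonneg j r hr))

/-- If a single-terminal Lagrangian without slack at zero rate is nonnegative, its derivatives at
zero are nonnegative. -/
theorem le_of_unitLagrangian_nonneg {A₀ β lam : ℝ} {φ : Fin N → ℝ}
    (hA : A₀ = β * P)
    (h : ∀ r : Fin N → ℝ, (∀ n, 0 ≤ r n) → 0 ≤ unitLagrangian a A₀ P φ β lam r) (n : Fin N) :
    lam ≤ β * a / φ n := by
  have hd : HasDerivAt (fun x : ℝ => β * (exp (a * x) - 1) / φ n - lam * x)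
      (β * a / φ n - lam) 0 := by
    have h1 : HasDerivAt (fun x : ℝ => a * x) a 0 := by
      simpa using (hasDerivAt_id (0 : ℝ)).const_mul a
    have h2 := (((h1.exp.sub_const 1).const_mul β).div_const (φ n)).sub
      ((hasDerivAt_id (0 : ℝ)).const_mul lam)
    exact h2.congr_deriv (by simp)
  have hpos : ∀ x : ℝ, 0 ≤ x → 0 ≤ β * (exp (a * x) - 1) / φ n - lam * x := by
    intro x hx
    have h3 := h (Pi.single n x) fun i => by
      rcases eq_or_ne i n with rfl | hi
      · simpa
      · simp [hi]
    rw [unitLagrangian, sum_eq_single n] at h3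
    · rw [Pi.single_eq_same] at h3
      linarith
    · intro i _ hi
      simp [hi]
    · simp
  have ht := hd.tendsto_slope_zero_right
  have : 0 ≤ β * a / φ n - lam := by
    refine ge_of_tendsto ht ?_
    filter_upwards [self_mem_nhdsWithin] with x hx
    have hx0 : (0 : ℝ) < x := hx
    have := hpos x hx0.le
    simpa using mul_nonneg (inv_nonneg.2 hx0.le) this
  linarith

/-- Once `lam ≤ β * a / φ n`, a slack quadratic in `δ` suffices to raise the rate multiplier
by `δ`. -/
theorem unitLagrangian_scale_add_nonneg {A₀ β lam c δ : ℝ} {φ : Fin N → ℝ} (ha : 0 < a)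
    (hβ : 0 < β) (hφ : ∀ n, 0 < φ n) (hA : A₀ = β * P) (hlam : ∀ n, lam ≤ β * a / φ n)
    (hc : 1 / 2 ≤ c) (hδ : δ ^ 2 * ∑ n, φ n / (β * a ^ 2) ≤ (1 - c) * A₀)
    {r : Fin N → ℝ} (hr : ∀ n, 0 ≤ r n) :
    0 ≤ unitLagrangian a A₀ P φ (c * β) (c * lam + δ) r := by
  have hterm : ∀ n, -(δ ^ 2 * (φ n / (β * a ^ 2)))
      ≤ c * β * (exp (a * r n) - 1) / φ n - (c * lam + δ) * r n := by
    intro n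
    have hn := hφ n
    have hrn := hr n
    have hexp := quadratic_le_exp_of_nonneg (mul_nonneg ha.le hrn)
    have h1 : c * lam * r n ≤ c * (β * a / φ n) * r n := by
      gcongr
      exact hlam n
    have h2 : c * β * (a * r n + (a * r n) ^ 2 / 2) / φ n
        ≤ c * β * (exp (a * r n) - 1) / φ n := by
      gcongr
      linarith
    have h3 : c * β * (a * r n + (a * r n) ^ 2 / 2) / φ n
        = c * (β * a / φ n) * r n + c * (2⁻¹ * (β * a ^ 2 / φ n) * r n ^ 2) := by
      field_simp
    obtain ⟨q, hq⟩ : ∃ q, q = β * a ^ 2 / φ n := ⟨_, rfl⟩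
    have hq0 : 0 < q := by rw [hq]; positivity
    have h4 : φ n / (β * a ^ 2) = q⁻¹ := by rw [hq, inv_div]
    have h5 : 1 / 2 * (2⁻¹ * q * r n ^ 2) ≤ c * (2⁻¹ * q * r n ^ 2) := by gcongr
    have h6 : δ ^ 2 * q⁻¹ + 1 / 2 * (2⁻¹ * q * r n ^ 2) - δ * r n
        = q⁻¹ * (δ - q * r n / 2) ^ 2 := by
      field_simp
      ring
    have h7 : 0 ≤ q⁻¹ * (δ - q * r n / 2) ^ 2 := by positivity
    rw [h4]
    rw [← hq] at h3
    linarith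
  have hsum := sum_le_sum fun n (_ : n ∈ univ) => hterm n
  rw [sum_neg_distrib, ← mul_sum] at hsum
  have hslack : A₀ - c * β * P = (1 - c) * A₀ := by rw [hA]; ring
  rw [unitLagrangian, hslack]
  linarith

/-- A dual optimum leaves strict slack at zero rate. -/
theorem mul_lt_of_isMax {lam : Fin K → ℝ} {β : ℝ} (ha : 0 < a) (hf : ∀ k n, 0 < f k n)
    (hQ : ∀ k, 0 < Q k) (hA : ∀ k, 0 < A k) (hlam : ∀ k, 0 ≤ lam k) (hβ : 0 < β)
    (hnonneg : ∀ k, ∀ r : Fin N → ℝ, (∀ n, 0 ≤ r n) →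
      0 ≤ unitLagrangian a (A k) P (f k) β (lam k) r)
    (hmax : ∀ (lam' : Fin K → ℝ) (β' : ℝ), (∀ k, 0 ≤ lam' k) → 0 ≤ β' →
      sInf (lagrangianValues a P A f Q lam' β') ≤ sInf (lagrangianValues a P A f Q lam β))
    (k : Fin K) : β * P < A k := by
  have h0 : β * P ≤ A k := by
    simpa [unitLagrangian] using hnonneg k 0 fun _ => le_rfl
  refine lt_of_le_of_ne h0 fun heq => ?_
  have hAk := hA k
  have hQk := hQ k
  obtain ⟨B, hB⟩ : ∃ B, B = ∑ n, f k n / (β * a ^ 2) := ⟨_, rfl⟩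
  have hB0 : 0 ≤ B := hB ▸ sum_nonneg fun n _ => by have := hf k n; positivity
  obtain ⟨G, hG⟩ : ∃ G, G = ∑ j, lam j * Q j := ⟨_, rfl⟩
  have hG0 : 0 ≤ G := hG ▸ sum_nonneg fun j _ => mul_nonneg (hlam j) (hQ j).le
  obtain ⟨M, hM⟩ : ∃ M, M = B / A k := ⟨_, rfl⟩
  have hM0 : 0 ≤ M := by rw [hM]; positivity
  have hsmall : ∀ᶠ δ : ℝ in nhdsWithin 0 (Set.Ioi 0), δ ^ 2 * M < 1 / 2 ∧ δ * (M * G) < Q k := by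
    have h1 : Filter.Tendsto (fun δ : ℝ => δ ^ 2 * M) (nhds 0) (nhds 0) := by
      have : Continuous fun δ : ℝ => δ ^ 2 * M := by fun_prop
      simpa using this.tendsto 0
    have h2 : Filter.Tendsto (fun δ : ℝ => δ * (M * G)) (nhds 0) (nhds 0) := by
      have : Continuous fun δ : ℝ => δ * (M * G) := by fun_prop
      simpa using this.tendsto 0
    exact ((h1.eventually_lt_const (by norm_num)).and
      (h2.eventually_lt_const hQk)).filter_mono nhdsWithin_le_nhds
  obtain ⟨δ, ⟨h1, h2⟩, hδ⟩ := (hsmall.and self_mem_nhdsWithin).exists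
  have hδ0 : 0 < δ := hδ
  have h := scale_add_le_of_isMax hA hlam hβ.le hnonneg hmax k (c := 1 - δ ^ 2 * M) (δ := δ)
    (by linarith) (by linarith [mul_nonneg (sq_nonneg δ) hM0]) hδ0.le fun r hr =>
      unitLagrangian_scale_add_nonneg ha hβ (hf k) heq.symm
        (le_of_unitLagrangian_nonneg heq.symm (hnonneg k)) (by linarith)
        (by rw [← hB, hM]; apply le_of_eq; field_simp; ring) hr
  rw [← hG] at h
  nlinarith [mul_lt_mul_of_pos_left h2 hδ0]

/-- At a dual optimum the minimum of every single-terminal Lagrangian vanishes. -/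
theorem sum_rateMin_eq_zero_of_isMax {lam : Fin K → ℝ} {β : ℝ} (ha : 0 < a)
    (hf : ∀ k n, 0 < f k n) (hQ : ∀ k, 0 < Q k) (hA : ∀ k, 0 < A k) (hlam : ∀ k, 0 ≤ lam k)
    (hβ : 0 < β)
    (hnonneg : ∀ k, ∀ r : Fin N → ℝ, (∀ n, 0 ≤ r n) →
      0 ≤ unitLagrangian a (A k) P (f k) β (lam k) r)
    (hmax : ∀ (lam' : Fin K → ℝ) (β' : ℝ), (∀ k, 0 ≤ lam' k) → 0 ≤ β' →
      sInf (lagrangianValues a P A f Q lam' β') ≤ sInf (lagrangianValues a P A f Q lam β))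
    (k : Fin K) : A k - β * P + ∑ n, rateMin a β (lam k) (f k n) = 0 := by
  have hge : 0 ≤ A k - β * P + ∑ n, rateMin a β (lam k) (f k n) := by
    choose r hr hreq using fun n => exists_rateMin_eq ha hβ (hlam k) (hf k n)
    simpa only [unitLagrangian, hreq] using hnonneg k r hr
  refine (hge.lt_or_eq.resolve_left fun hpos => ?_).symm
  have hcont := (continuousWithinAt_sum_rateMin ha hβ (hf k) (hlam k)).const_add (A k - β * P)
  have hev := (hcont.mono (Set.Ioi_subset_Ici (hlam k))).eventually_const_lt hpos
  obtain ⟨l, hl, hlt⟩ := (hev.and self_mem_nhdsWithin).exists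
  have hlt' : lam k < l := hlt
  have h := scale_add_le_of_isMax hA hlam hβ.le hnonneg hmax k (c := 1) (δ := l - lam k)
    zero_le_one le_rfl (by linarith) fun r hr => by
      rw [one_mul, one_mul, add_sub_cancel]
      refine hl.le.trans (add_le_add_right (sum_le_sum fun n _ => ?_) _)
      exact rateMin_le ha hβ ((hlam k).trans hlt'.le) (hf k n) (hr n)
  nlinarith [mul_pos (sub_pos.2 hlt') (hQ k)]

theorem multiplier_pos_of_nonneg {A₀ β lam : ℝ} {φ : Fin N → ℝ} (hN : 0 < N) (hβ : 0 ≤ β)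
    (hlam : 0 < lam)
    (h : ∀ r : Fin N → ℝ, (∀ n, 0 ≤ r n) → 0 ≤ unitLagrangian a A₀ P φ β lam r) : 0 < β := by
  refine hβ.lt_of_ne fun h0 => ?_
  have hN' : (1 : ℝ) ≤ N := by exact_mod_cast hN
  have hx : 0 ≤ (|A₀| + 1) / lam := by positivity
  have h1 := h (fun _ => (|A₀| + 1) / lam) fun _ => hx
  simp only [unitLagrangian, ← h0, zero_mul, zero_div, sub_zero, zero_sub, sum_const, card_univ,
    Fintype.card_fin, nsmul_eq_mul, mul_div_cancel₀ _ hlam.ne'] at h1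
  nlinarith [le_abs_self A₀, abs_nonneg A₀]

end Dual

/-- If (λ*, β*) ≥ 0 attains the supremum of the dual function g of
problem (P1) and g(λ*, β*) = V (strong duality), then λ*_k > 0 for every k,
β* > 0, β* < (min_k α_k)·P_rc/P_avg, and for every k the stationarity equation
α_k·P_rc − β*·P_avg + Σ_n u_{k,n}(β*, λ*_k) = 0 holds. -/
theorem p1_dual_optimal_properties
    (K N : ℕ) (hK : 0 < K) (hN : 0 < N)
    (a : ℝ) (ha : 0 < a)
    (f : Fin K → Fin N → ℝ) (hf : ∀ k n, 0 < f k n)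
    (Q : Fin K → ℝ) (hQ : ∀ k, 0 < Q k)
    (Pavg : ℝ) (hPavg : 0 < Pavg)
    (Prc : ℝ) (hPrc : 0 < Prc)
    (α : Fin K → ℝ) (hα : ∀ k, 0 < α k)
    (g : (Fin K → ℝ) → ℝ → ℝ)
    (hg : ∀ (lam : Fin K → ℝ) (β : ℝ),
      g lam β = sInf {y : ℝ | ∃ (s : Fin K → Fin N → ℝ) (t : Fin K → ℝ),
        (∀ k n, 0 ≤ s k n) ∧ (∀ k, 0 < t k) ∧
        y = (∑ k, α k * Prc * t k)
            - (∑ k, lam k * ((∑ n, s k n) - Q k))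
            + β * ((∑ k, ∑ n, t k * (Real.exp (a * s k n / t k) - 1) / f k n)
                - Pavg * ∑ k, t k)})
    (V : ℝ)
    (hV : V = sInf {E : ℝ | ∃ (s : Fin K → Fin N → ℝ) (t : Fin K → ℝ),
        (∀ k n, 0 ≤ s k n) ∧ (∀ k, 0 < t k) ∧
        (∀ k, Q k ≤ ∑ n, s k n) ∧
        (∑ k, ∑ n, t k * (Real.exp (a * s k n / t k) - 1) / f k n
          ≤ Pavg * ∑ k, t k) ∧
        E = ∑ k, α k * Prc * t k})
    (lamstar : Fin K → ℝ) (βstar : ℝ)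
    (hlamstar : ∀ k, 0 ≤ lamstar k) (hβstar : 0 ≤ βstar)
    (hmax : ∀ (lam : Fin K → ℝ) (β : ℝ),
      (∀ k, 0 ≤ lam k) → 0 ≤ β → g lam β ≤ g lamstar βstar)
    (hstrong : g lamstar βstar = V) :
    (∀ k, 0 < lamstar k) ∧
    0 < βstar ∧
    (∀ k, βstar < α k * Prc / Pavg) ∧
    (∀ k, α k * Prc - βstar * Pavg +
        ∑ n, (max (lamstar k / a - βstar / f k n) 0
          - lamstar k / a * max (Real.log (lamstar k * f k n / (a * βstar))) 0)
      = 0) := by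
  have hA : ∀ k, 0 < α k * Prc := fun k => mul_pos (hα k) hPrc
  have hg' : ∀ lam β, g lam β
      = sInf (lagrangianValues a Pavg (fun k => α k * Prc) f Q lam β) := hg
  have hVpos : 0 < V :=
    hV ▸ sInf_primalValues_pos (A := fun k => α k * Prc) hK hN ha hPavg hf hQ hA
  simp only [hg'] at hmax hstrong
  have hbdd : BddBelow (lagrangianValues a Pavg (fun k => α k * Prc) f Q lamstar βstar) := by
    by_contra hb
    rw [Real.sInf_of_not_bddBelow hb] at hstrong
    exact hVpos.ne hstrong
  have hnonneg : ∀ k, ∀ r : Fin N → ℝ, (∀ n, 0 ≤ r n) →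
      0 ≤ unitLagrangian a (α k * Prc) Pavg (f k) βstar (lamstar k) r :=
    fun k r hr => unitLagrangian_nonneg_of_bddBelow hbdd k hr
  obtain ⟨j, hj⟩ : ∃ j, 0 < lamstar j := by
    by_contra! hle
    rw [sInf_lagrangianValues hnonneg] at hstrong
    have : ∑ k, lamstar k * Q k ≤ 0 :=
      sum_nonpos fun k _ => mul_nonpos_of_nonpos_of_nonneg (hle k) (hQ k).le
    linarith
  have hβ : 0 < βstar := multiplier_pos_of_nonneg hN hβstar hj (hnonneg j)
  have hslack : ∀ k, βstar * Pavg < α k * Prc :=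
    mul_lt_of_isMax ha hf hQ hA hlamstar hβ hnonneg hmax
  have hstat : ∀ k, α k * Prc - βstar * Pavg + ∑ n, rateMin a βstar (lamstar k) (f k n) = 0 :=
    sum_rateMin_eq_zero_of_isMax ha hf hQ hA hlamstar hβ hnonneg hmax
  refine ⟨fun k => (hlamstar k).lt_of_ne fun h0 => ?_, hβ,
    fun k => (lt_div_iff₀ hPavg).2 (hslack k), hstat⟩
  have hzero : ∀ n, rateMin a βstar 0 (f k n) = 0 := fun n => by
    have : 0 ≤ βstar / f k n := div_nonneg hβ.le (hf k n).le
    simp [rateMin, this]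
  have h := hstat k
  simp only [← h0, hzero, sum_const_zero, add_zero] at h
  linarith [hslack k]
end
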